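/- arXiv:2305.13422 — 6 statements merged into one kernel-verified Lean document; each statement's English description precedes it below -/
import Mathlib

section
/- For every ε > 0 there exists a constant C_ε > 0 such that for all positive integers l and k with l ≥ C_ε · k^3 · (log k)^{1+ε}, one has f(l, k) = l^{k-1}. -/
/-- `r` is a tournament relation on `Fin n`: an orientation of the complete graph,
i.e. irreflexive and, for distinct vertices, exactly one direction is present. -/
def IsTournament {n : ℕ} (r : Fin n → Fin n → Prop) : Prop :=
  (∀ v, ¬ r v v) ∧ ∀ u v : Fin n, u ≠ v → (r u v ↔ ¬ r v u)

/-- `x` is a directed walk (of length `m`) in the digraph `r`;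
vertices and edges may repeat. -/
def IsWalk {n m : ℕ} (r : Fin n → Fin n → Prop) (x : Fin (m + 1) → Fin n) : Prop :=
  ∀ i : Fin m, r (x i.castSucc) (x i.succ)

/-- The sequence of colours along a sequence of `m + 1` vertices. -/
def walkColours {n m : ℕ} {α : Type} (c : Fin n → Fin n → α) (x : Fin (m + 1) → Fin n) :
    Fin m → α :=
  fun i => c (x i.castSucc) (x i.succ)

/-- The edge-coloured digraph `(r, c)` contains an `l`-flash: a directed walk of
length `l` all of whose edges have the same colour. -/
def HasFlash {n : ℕ} {α : Type} (l : ℕ) (r : Fin n → Fin n → Prop)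
    (c : Fin n → Fin n → α) : Prop :=
  ∃ x : Fin (l + 1) → Fin n, IsWalk r x ∧
    ∀ i j : Fin l, walkColours c x i = walkColours c x j

/-- The edge-coloured digraph `(r, c)` contains a `k`-rainbow: a directed walk of
length `k` whose edge colours are pairwise distinct. -/
def HasRainbow {n : ℕ} {α : Type} (k : ℕ) (r : Fin n → Fin n → Prop)
    (c : Fin n → Fin n → α) : Prop :=
  ∃ y : Fin (k + 1) → Fin n, IsWalk r y ∧ Function.Injective (walkColours c y)

/-- The set of `m` such that every edge colouring of any tournament with more than `m`
vertices contains an `l`-flash or a `k`-rainbow. -/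
def tSet (l k : ℕ) : Set ℕ :=
  {m | ∀ n : ℕ, n > m → ∀ r : Fin n → Fin n → Prop, IsTournament r →
    ∀ (α : Type) (c : Fin n → Fin n → α), HasFlash l r c ∨ HasRainbow k r c}

/-- `t l k` is the smallest integer such that every edge colouring of any tournament
with more than `t l k` vertices contains an `l`-flash or a `k`-rainbow. -/
noncomputable def t (l k : ℕ) : ℕ := sInf (tSet l k)
/-- The edge colouring `c` of the complete graph on `Fin n` contains a monotone
`l`-flash: vertices `x 0 < x 1 < ⋯ < x l` whose consecutive edges all get the
same colour. -/
def HasMonoFlash {n : ℕ} {α : Type} (l : ℕ) (c : Fin n → Fin n → α) : Prop :=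
  ∃ x : Fin (l + 1) → Fin n, StrictMono x ∧
    ∀ i j : Fin l, walkColours c x i = walkColours c x j

/-- The edge colouring `c` of the complete graph on `Fin n` contains a monotone
`k`-rainbow: vertices `y 0 < y 1 < ⋯ < y k` whose consecutive edges get pairwise
distinct colours. -/
def HasMonoRainbow {n : ℕ} {α : Type} (k : ℕ) (c : Fin n → Fin n → α) : Prop :=
  ∃ y : Fin (k + 1) → Fin n, StrictMono y ∧ Function.Injective (walkColours c y)

/-- The set of `m` such that for every `n > m`, every colouring of the edges of the
complete graph on `n` vertices (with an arbitrary set of colours) contains a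
monotone `l`-flash or a monotone `k`-rainbow. -/
def fSet (l k : ℕ) : Set ℕ :=
  {m | ∀ n : ℕ, n > m → ∀ (α : Type) (c : Fin n → Fin n → α),
    HasMonoFlash l c ∨ HasMonoRainbow k c}

/-- `f l k` is the smallest integer such that for every `n > f l k`, every colouring
of the edges of the complete graph on `n` vertices contains a monotone `l`-flash or
a monotone `k`-rainbow. -/
noncomputable def f (l k : ℕ) : ℕ := sInf (fSet l k)
/-- The set of colours on edges directed out of `v`. -/
def outColours {n : ℕ} {α : Type} (r : Fin n → Fin n → Prop) (c : Fin n → Fin n → α)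
    (v : Fin n) : Set α :=
  {a | ∃ u, r v u ∧ c v u = a}

/-- A vertex `v` is `rb`-in-robust if for every colour `a` there is an `rb`-rainbow
avoiding colour `a` that ends at `v`. -/
def IsInRobust {n : ℕ} {α : Type} (rb : ℕ) (r : Fin n → Fin n → Prop)
    (c : Fin n → Fin n → α) (v : Fin n) : Prop :=
  ∀ a : α, ∃ y : Fin (rb + 1) → Fin n, IsWalk r y ∧
    Function.Injective (walkColours c y) ∧ (∀ i, walkColours c y i ≠ a) ∧
    y (Fin.last rb) = v

/-- The set of `m` such that every tournament with more than `m` vertices, coloured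
with at most `k - 1` outgoing colours at each vertex, contains an `l`-flash, a
`k`-rainbow, or an `rb`-in-robust vertex. -/
def gSet (l k rb : ℕ) : Set ℕ :=
  {m | ∀ n : ℕ, n > m → ∀ r : Fin n → Fin n → Prop, IsTournament r →
    ∀ (α : Type) (c : Fin n → Fin n → α),
      (∀ v, (outColours r c v).ncard ≤ k - 1) →
      HasFlash l r c ∨ HasRainbow k r c ∨ ∃ v, IsInRobust rb r c v}

/-- `g l k rb` is the smallest integer such that every tournament with more than
`g l k rb` vertices, coloured with at most `k - 1` outgoing colours at each vertex,
contains an `l`-flash, a `k`-rainbow, or an `rb`-in-robust vertex. -/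
noncomputable def g (l k rb : ℕ) : ℕ := sInf (gSet l k rb)
/-- A vertex `v` is strongly `(k-2)`-robust if there is a set `C` of `k - 1` colours
containing every colour incident to `v` such that for every `a ∈ C` there is a
`(k-2)`-rainbow with colour set exactly `C \ {a}` ending at `v`, and also one
starting at `v`. -/
def IsStronglyRobust {n : ℕ} {α : Type} (k : ℕ) (r : Fin n → Fin n → Prop)
    (c : Fin n → Fin n → α) (v : Fin n) : Prop :=
  ∃ C : Finset α, C.card = k - 1 ∧
    (∀ u : Fin n, (r u v → c u v ∈ C) ∧ (r v u → c v u ∈ C)) ∧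
    ∀ a ∈ C,
      (∃ y : Fin (k - 2 + 1) → Fin n, IsWalk r y ∧
        Function.Injective (walkColours c y) ∧
        Set.range (walkColours c y) = ↑C \ {a} ∧ y (Fin.last (k - 2)) = v) ∧
      (∃ y : Fin (k - 2 + 1) → Fin n, IsWalk r y ∧
        Function.Injective (walkColours c y) ∧
        Set.range (walkColours c y) = ↑C \ {a} ∧ y 0 = v)


section FlashCore

open Classical in
/-- `Rb lt c V u v S`: there is a rainbow inside `V`, increasing for `lt`, from `u` to `v`,
with colour set exactly `S`. -/
inductive Rb {ι α : Type} (lt : ι → ι → Prop) (c : ι → ι → α) (V : Finset ι) :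
    ι → ι → Finset α → Prop
  | refl {v : ι} : v ∈ V → Rb lt c V v v ∅
  | snoc {u v w : ι} {S : Finset α} : Rb lt c V u v S → w ∈ V → lt v w → c v w ∉ S →
      Rb lt c V u w (insert (c v w) S)

/-- No rainbow with more than `m` edges. -/
def NoRb {ι α : Type} (lt : ι → ι → Prop) (c : ι → ι → α) (V : Finset ι) (m : ℕ) : Prop :=
  ∀ u v S, Rb lt c V u v S → S.card ≤ m

variable {ι α : Type} {lt : ι → ι → Prop} {c : ι → ι → α} {V W : Finset ι}

theorem Rb.mem_right {u v : ι} {S : Finset α} (h : Rb lt c V u v S) : v ∈ V := by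
  cases h <;> assumption

theorem Rb.mem_left {u v : ι} {S : Finset α} (h : Rb lt c V u v S) : u ∈ V := by
  induction h with
  | refl h => exact h
  | snoc _ _ _ _ ih => exact ih

theorem Rb.mono (hVW : V ⊆ W) {u v : ι} {S : Finset α} (h : Rb lt c V u v S) :
    Rb lt c W u v S := by
  induction h with
  | refl h => exact Rb.refl (hVW h)
  | snoc _ hw hl hc ih => exact Rb.snoc ih (hVW hw) hl hc

open Classical in
theorem Rb.trans {u v w : ι} {S T : Finset α} (h : Rb lt c V u v S) (h' : Rb lt c V v w T)
    (hd : Disjoint S T) : Rb lt c V u w (S ∪ T) := by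
  induction h' with
  | refl _ => simpa using h
  | snoc h1 hw hl hc ih =>
    rw [Finset.disjoint_insert_right] at hd
    rw [Finset.union_insert]
    refine Rb.snoc (ih hd.2) hw hl ?_
    rw [Finset.mem_union]
    rintro (h | h)
    · exact hd.1 h
    · exact hc h

open Classical in
theorem Rb.cons {u v w : ι} {S : Finset α} (hu : u ∈ V) (hl : lt u v) (h : Rb lt c V v w S)
    (hc : c u v ∉ S) : Rb lt c V u w (insert (c u v) S) := by
  have h1 : Rb lt c V u v (insert (c u v) ∅) :=
    Rb.snoc (Rb.refl hu) h.mem_left hl (by simp)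
  have := h1.trans h (by simpa using hc)
  simpa [Finset.insert_union] using this

open Classical in
theorem Rb.dual {u v : ι} {S : Finset α} (h : Rb lt c V u v S) :
    Rb (fun a b => lt b a) (fun a b => c b a) V v u S := by
  induction h with
  | refl h => exact Rb.refl h
  | snoc h1 hw hl hc ih =>
    exact Rb.cons (lt := fun a b => lt b a) (c := fun a b => c b a) hw hl ih hc

theorem NoRb.dual {m : ℕ} (h : NoRb lt c V m) :
    NoRb (fun a b => lt b a) (fun a b => c b a) V m :=
  fun u v S hS => h v u S hS.dual

theorem NoRb.mono {m : ℕ} (hVW : W ⊆ V) (h : NoRb lt c V m) : NoRb lt c W m :=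
  fun u v S hS => h u v S (hS.mono hVW)

theorem Rb.trunc {u v : ι} {S : Finset α} (h : Rb lt c V u v S) (j : ℕ) (hj : j ≤ S.card) :
    ∃ w T, Rb lt c V u w T ∧ T.card = j := by
  classical
  induction h with
  | refl h => exact ⟨_, ∅, Rb.refl h, by simp at hj; simp [hj]⟩
  | @snoc v w S h1 hw hl hc ih =>
    by_cases hj' : j ≤ S.card
    · exact ih hj'
    · refine ⟨_, _, Rb.snoc h1 hw hl hc, ?_⟩
      rw [Finset.card_insert_of_notMem hc] at hj ⊢
      omega

/-- `v` is `r`-robust from the in side. -/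
def InRob (lt : ι → ι → Prop) (c : ι → ι → α) (V : Finset ι) (r : ℕ) (v : ι) : Prop :=
  ∀ a : α, ∃ u S, Rb lt c V u v S ∧ S.card = r ∧ a ∉ S

/-- out-colours lie in the colour set of every maximal rainbow. -/
theorem out_mem {m : ℕ} (hV : NoRb lt c V m) {u v w : ι} {S : Finset α}
    (h : Rb lt c V u v S) (hS : S.card = m) (hw : w ∈ V) (hl : lt v w) : c v w ∈ S := by
  classical
  by_contra hc
  have := hV _ _ _ (Rb.snoc h hw hl hc)
  rw [Finset.card_insert_of_notMem hc] at this
  omega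

open Classical in
/-- The class bound for vertices which are `(r-1)`-robust but not `r`-robust. -/
theorem card_notRob (m l r : ℕ) (hr : 1 ≤ r) (hrm : r < m)
    (ψ : α → ι → ℕ) (hψ : ∀ a v, ψ a v < l)
    (hinc : ∀ u v, lt u v → ψ (c u v) u ≠ ψ (c u v) v)
    (hmin : ∀ W : Finset ι, W.Nonempty → ∃ x ∈ W, ∀ v ∈ W, v ≠ x → lt x v)
    (IH : ∀ W, NoRb lt c W (r - 1) → W.card ≤ l ^ (r - 1))
    (hV : NoRb lt c V m) (N : Finset ι) (hN : N ⊆ V)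
    (h1 : ∀ v ∈ N, ∃ u S, Rb lt c V u v S ∧ S.card = m)
    (h2 : ∀ v ∈ N, InRob lt c V (r - 1) v)
    (h3 : ∀ v ∈ N, ¬ InRob lt c V r v) :
    N.card ≤ 1 + m * (m * (l * l ^ (r - 1))) := by
  rcases N.eq_empty_or_nonempty with rfl | hne
  · simp
  obtain ⟨x, hx, hxmin⟩ := hmin N hne
  obtain ⟨u0, S0, hS0, hS0c⟩ := h1 x hx
  choose p R hR hRc hRa using h2 x hx
  have h3' : ∀ v ∈ N, ∃ b, ∀ u S, Rb lt c V u v S → S.card = r → b ∈ S := by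
    intro v hv
    have := h3 v hv
    unfold InRob at this
    push Not at this
    exact this
  have : Nonempty α := ⟨(h3' x hx).choose⟩
  choose! b hb using h3'
  have hsub : N ⊆ {x} ∪ S0.biUnion (fun d => (insert d (R d)).biUnion (fun e =>
      (Finset.range l).biUnion (fun i => N.filter (fun v => b v = e ∧ ψ e v = i)))) := by
    intro v hv
    by_cases hvx : v = x
    · simp [hvx]
    have hl := hxmin v hv hvx
    refine Finset.mem_union_right _ ?_
    simp only [Finset.mem_biUnion]
    refine ⟨c x v, out_mem hV hS0 hS0c (hN hv) hl, b v, ?_, ψ (b v) v, by simp [hψ], by simp [hv]⟩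
    refine hb v hv (p (c x v)) _ (Rb.snoc (hR _) (hN hv) hl (hRa _)) ?_
    rw [Finset.card_insert_of_notMem (hRa _), hRc]
    omega
  refine (Finset.card_le_card hsub).trans ((Finset.card_union_le _ _).trans ?_)
  rw [Finset.card_singleton]
  refine Nat.add_le_add_left ?_ 1
  rw [← hS0c]
  refine Finset.card_biUnion_le_card_mul _ _ _ ?_
  intro d _
  have hcard : (insert d (R d)).card ≤ S0.card := by
    rw [Finset.card_insert_of_notMem (hRa _), hRc]
    omega
  refine le_trans ?_ (Nat.mul_le_mul_right _ hcard)
  refine Finset.card_biUnion_le_card_mul _ _ _ ?_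
  intro e _
  have : l = (Finset.range l).card := by simp
  conv_rhs => rw [this]
  rw [Finset.card_range]
  refine le_trans (Finset.card_biUnion_le_card_mul _ _ (l ^ (r - 1)) ?_) (by simp)
  intro i _
  apply IH
  intro u v S hS
  by_contra hlt
  obtain ⟨w, T, hT, hTc⟩ := hS.trunc r (by omega)
  have key : ∀ u v S, Rb lt c (N.filter (fun v => b v = e ∧ ψ e v = i)) u v S → e ∉ S := by
    intro u v S h
    induction h with
    | refl _ => simp
    | snoc h1 hw hl hc ih =>
      rw [Finset.mem_insert]
      rintro (h | h)
      · have hv := h1.mem_right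
        rw [Finset.mem_filter] at hv hw
        have := hinc _ _ hl
        rw [← h, hv.2.2, hw.2.2] at this
        exact this rfl
      · exact ih h
  have hw := hT.mem_right
  rw [Finset.mem_filter] at hw
  have := hb w hw.1 u T (hT.mono ((Finset.filter_subset _ _).trans hN)) hTc
  rw [hw.2.1] at this
  exact key _ _ _ hT this

open Classical in
/-- vertices that are bad from the in side -/
noncomputable def badIn (lt : ι → ι → Prop) (c : ι → ι → α) (V : Finset ι) (m : ℕ) : Finset ι :=
  V.filter (fun v => ¬ ((∃ u S, Rb lt c V u v S ∧ S.card = m) ∧ InRob lt c V (m - 1) v))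

open Classical in
theorem card_badIn (m l : ℕ) (hm : 1 ≤ m) (hl : 1 ≤ l)
    (ψ : α → ι → ℕ) (hψ : ∀ a v, ψ a v < l)
    (hinc : ∀ u v, lt u v → ψ (c u v) u ≠ ψ (c u v) v)
    (hmin : ∀ W : Finset ι, W.Nonempty → ∃ x ∈ W, ∀ v ∈ W, v ≠ x → lt x v)
    (IH : ∀ j < m, ∀ W, NoRb lt c W j → W.card ≤ l ^ j)
    (hV : NoRb lt c V m) :
    (badIn lt c V m).card ≤ l ^ (m - 1) + m * (1 + m * (m * l ^ (m - 1))) := by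
  set E := V.filter (fun v => ¬ ∃ u S, Rb lt c V u v S ∧ S.card = m) with hE
  set N : ℕ → Finset ι := fun r => V.filter (fun v => (∃ u S, Rb lt c V u v S ∧ S.card = m) ∧
    InRob lt c V (r - 1) v ∧ ¬ InRob lt c V r v) with hN
  have hsub : badIn lt c V m ⊆ E ∪ (Finset.Ico 1 m).biUnion N := by
    intro v hv
    rw [badIn, Finset.mem_filter] at hv
    by_cases he : ∃ u S, Rb lt c V u v S ∧ S.card = m
    · have hnr : ¬ InRob lt c V (m - 1) v := fun h => hv.2 ⟨he, h⟩
      refine Finset.mem_union_right _ ?_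
      have hex : ∃ r, ¬ InRob lt c V r v := ⟨_, hnr⟩
      have h0 : InRob lt c V 0 v := fun a => ⟨v, ∅, Rb.refl hv.1, by simp, by simp⟩
      have hf := Nat.find_spec hex
      have hf0 : Nat.find hex ≠ 0 := by
        intro h
        rw [h] at hf
        exact hf h0
      have hle : Nat.find hex ≤ m - 1 := Nat.find_min' hex hnr
      have hpred : InRob lt c V (Nat.find hex - 1) v := by
        have := Nat.find_min hex (m := Nat.find hex - 1) (by omega)
        simpa using this
      rw [Finset.mem_biUnion]
      refine ⟨Nat.find hex, by rw [Finset.mem_Ico]; omega, ?_⟩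
      rw [hN, Finset.mem_filter]
      exact ⟨hv.1, he, hpred, hf⟩
    · refine Finset.mem_union_left _ ?_
      rw [hE, Finset.mem_filter]
      exact ⟨hv.1, he⟩
  refine (Finset.card_le_card hsub).trans ((Finset.card_union_le _ _).trans ?_)
  refine Nat.add_le_add ?_ ?_
  · refine IH (m - 1) (by omega) E ?_
    intro u v S hS
    by_contra hlt
    obtain ⟨w, T, hT, hTc⟩ := hS.trunc m (by omega)
    have hw := hT.mem_right
    rw [hE, Finset.mem_filter] at hw
    exact hw.2 ⟨u, T, hT.mono (Finset.filter_subset _ _), hTc⟩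
  · refine (Finset.card_biUnion_le_card_mul _ _ (1 + m * (m * l ^ (m - 1))) ?_).trans ?_
    · intro r hr
      rw [Finset.mem_Ico] at hr
      have := card_notRob m l r hr.1 hr.2 ψ hψ hinc hmin (IH (r - 1) (by omega)) hV (N r)
        (Finset.filter_subset _ _)
        (fun v hv => by rw [hN, Finset.mem_filter] at hv; exact hv.2.1)
        (fun v hv => by rw [hN, Finset.mem_filter] at hv; exact hv.2.2.1)
        (fun v hv => by rw [hN, Finset.mem_filter] at hv; exact hv.2.2.2)
      refine this.trans ?_
      have h1 : l * l ^ (r - 1) = l ^ r := by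
        rw [← pow_succ']
        congr 1
        omega
      rw [h1]
      gcongr
      omega
    · gcongr
      rw [Nat.card_Ico]
      omega

end FlashCore

section FlashStrong

variable {ι α : Type} [LinearOrder ι] {c : ι → ι → α} {V : Finset ι}

/-- At a strong vertex, edges whose colour is not in `C` have to jump over `v`. -/
theorem strong_side {m : ℕ} (hV : NoRb (· < ·) c V m) {v : ι} {C : Finset α} (hC : C.card = m)
    (hin : ∀ u ∈ V, u < v → c u v ∈ C) (hout : ∀ u ∈ V, v < u → c v u ∈ C)
    (hrin : ∀ a ∈ C, ∃ u S, Rb (· < ·) c V u v S ∧ a ∉ S ∧ S.card + 1 = m ∧ S ⊆ C)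
    (hrout : ∀ a ∈ C, ∃ u S, Rb (· < ·) c V v u S ∧ a ∉ S ∧ S.card + 1 = m ∧ S ⊆ C)
    {p q : ι} (hp : p ∈ V) (hq : q ∈ V) (hpq : p < q) (hc : c p q ∉ C) : p < v ∧ v < q := by
  classical
  constructor
  · by_contra hlt
    rcases (not_lt.1 hlt).eq_or_lt with rfl | hvp
    · exact hc (hout q hq hpq)
    obtain ⟨u, S, hS, haS, hSc, hSC⟩ := hrin _ (hout p hp hvp)
    have h1 := Rb.snoc hS hp hvp haS
    have h2 := Rb.snoc h1 hq hpq (by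
      rw [Finset.mem_insert]
      rintro (h | h)
      · exact hc (h ▸ hout p hp hvp)
      · exact hc (hSC h))
    have h3 := out_mem hV h1 (by rw [Finset.card_insert_of_notMem haS, hSc]) hq hpq
    rw [Finset.mem_insert] at h3
    rcases h3 with h | h
    · exact hc (h ▸ hout p hp hvp)
    · exact hc (hSC h)
  · by_contra hlt
    rcases (not_lt.1 hlt).eq_or_lt with rfl | hvq
    · exact hc (hin p hp hpq)
    obtain ⟨u, S, hS, haS, hSc, hSC⟩ := hrout _ (hin q hq hvq)
    have h1 := Rb.cons (lt := (· < ·)) hq hvq hS haS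
    have h3 : c p q ∉ insert (c q v) S := by
      rw [Finset.mem_insert]
      rintro (h | h)
      · exact hc (h ▸ hin q hq hvq)
      · exact hc (hSC h)
    have h2 := hV _ _ _ (Rb.cons (lt := (· < ·)) hp hpq h1 h3)
    rw [Finset.card_insert_of_notMem h3, Finset.card_insert_of_notMem haS] at h2
    omega

theorem pathDown (s : α → ι) (x : ι) (hx : x ∈ V) (D : Finset α)
    (hs : ∀ a ∈ D, s a ∈ V ∧ s a < x ∧ c (s a) x = a)
    (hss : ∀ a ∈ D, ∀ b ∈ D, a ≠ b → s a ≠ s b ∧ (s a < s b → c (s a) (s b) = a)) :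
    ∃ u, Rb (· < ·) c V u x D ∧ (u = x ∨ ∃ a ∈ D, u = s a) := by
  classical
  induction D using Finset.induction_on_min_value s with
  | empty => exact ⟨x, Rb.refl hx, Or.inl rfl⟩
  | insert a D haD hmin ih =>
    obtain ⟨u, hu, hu'⟩ := ih (fun b hb => hs b (Finset.mem_insert_of_mem hb))
      (fun b hb b' hb' => hss b (Finset.mem_insert_of_mem hb) b' (Finset.mem_insert_of_mem hb'))
    have ha := hs a (Finset.mem_insert_self _ _)
    have key : s a < u ∧ c (s a) u = a := by
      rcases hu' with rfl | ⟨b, hb, rfl⟩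
      · exact ha.2
      · have hab : a ≠ b := fun h => haD (h ▸ hb)
        have h := hss a (Finset.mem_insert_self _ _) b (Finset.mem_insert_of_mem hb) hab
        have hlt := lt_of_le_of_ne (hmin b hb) h.1
        exact ⟨hlt, h.2 hlt⟩
    refine ⟨s a, ?_, Or.inr ⟨a, Finset.mem_insert_self _ _, rfl⟩⟩
    have := Rb.cons (lt := (· < ·)) ha.1 key.1 hu (by rw [key.2]; exact haD)
    rwa [key.2] at this

theorem pathUp (s : α → ι) (x : ι) (hx : x ∈ V) (D : Finset α)
    (hs : ∀ a ∈ D, s a ∈ V ∧ x < s a ∧ c x (s a) = a)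
    (hss : ∀ a ∈ D, ∀ b ∈ D, a ≠ b → s a ≠ s b ∧ (s a < s b → c (s a) (s b) = b)) :
    ∃ u, Rb (· < ·) c V x u D ∧ (u = x ∨ ∃ a ∈ D, u = s a) := by
  classical
  induction D using Finset.induction_on_max_value s with
  | empty => exact ⟨x, Rb.refl hx, Or.inl rfl⟩
  | insert a D haD hmin ih =>
    obtain ⟨u, hu, hu'⟩ := ih (fun b hb => hs b (Finset.mem_insert_of_mem hb))
      (fun b hb b' hb' => hss b (Finset.mem_insert_of_mem hb) b' (Finset.mem_insert_of_mem hb'))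
    have ha := hs a (Finset.mem_insert_self _ _)
    have key : u < s a ∧ c u (s a) = a := by
      rcases hu' with rfl | ⟨b, hb, rfl⟩
      · exact ha.2
      · have hab : b ≠ a := fun h => haD (h ▸ hb)
        have h := hss b (Finset.mem_insert_of_mem hb) a (Finset.mem_insert_self _ _) hab
        have hlt := lt_of_le_of_ne (hmin b hb) h.1
        exact ⟨hlt, h.2 hlt⟩
    refine ⟨s a, ?_, Or.inr ⟨a, Finset.mem_insert_self _ _, rfl⟩⟩
    have := Rb.snoc hu ha.1 key.1 (by rw [key.2]; exact haD)
    rwa [key.2] at this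

/-- If `x < y` have the same label then some axis line through the label is otherwise empty. -/
theorem line_free {m : ℕ} (hV : NoRb (· < ·) c V m) {v : ι} (hv : v ∈ V) {C : Finset α}
    (hC : C.card = m) (ψ : α → ι → ℕ)
    (hinc : ∀ u v, u < v → ψ (c u v) u < ψ (c u v) v)
    (hin : ∀ u ∈ V, u < v → c u v ∈ C) (hout : ∀ u ∈ V, v < u → c v u ∈ C)
    (side : ∀ p ∈ V, ∀ q ∈ V, p < q → c p q ∉ C → p < v ∧ v < q)
    {x y : ι} (hx : x ∈ V) (hy : y ∈ V) (hxy : x < y) (hlab : ∀ a ∈ C, ψ a x = ψ a y) :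
    ∃ a ∈ C, ∀ p ∈ V, (∀ b ∈ C, b ≠ a → ψ b p = ψ b x) → ψ a p = ψ a x := by
  classical
  have hcxy : c x y ∉ C := fun h => by
    have := hinc _ _ hxy
    rw [hlab _ h] at this
    exact lt_irrefl _ this
  obtain ⟨hxv, hvy⟩ := side x hx y hy hxy hcxy
  by_contra hcon
  push Not at hcon
  have hcon' : ∀ a, ∃ p, a ∈ C → (p ∈ V ∧ (∀ b ∈ C, b ≠ a → ψ b p = ψ b x) ∧ ψ a p ≠ ψ a x) := by
    intro a
    by_cases ha : a ∈ C
    · obtain ⟨p, hp⟩ := hcon a ha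
      exact ⟨p, fun _ => hp⟩
    · exact ⟨x, fun h => absurd h ha⟩
  choose s hs using hcon'
  have same : ∀ p ∈ V, ∀ q ∈ V, p < q → ¬ (p < v ∧ v < q) → c p q ∈ C := by
    intro p hp q hq hpq h
    by_contra h'
    exact h (side p hp q hq hpq h')
  have toZ : ∀ a ∈ C, ∀ t ∈ V, (∀ b ∈ C, ψ b t = ψ b x) → s a < t → c (s a) t ∈ C →
      c (s a) t = a ∧ ψ a (s a) < ψ a x := by
    intro a ha t ht htz hlt hcC
    have h1 := hinc _ _ hlt
    have h2 : c (s a) t = a := by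
      by_contra hne
      rw [(hs a ha).2.1 _ hcC hne, htz _ hcC] at h1
      exact lt_irrefl _ h1
    rw [h2, htz a ha] at h1
    exact ⟨h2, h1⟩
  have fromZ : ∀ a ∈ C, ∀ t ∈ V, (∀ b ∈ C, ψ b t = ψ b x) → t < s a → c t (s a) ∈ C →
      c t (s a) = a ∧ ψ a x < ψ a (s a) := by
    intro a ha t ht htz hlt hcC
    have h1 := hinc _ _ hlt
    have h2 : c t (s a) = a := by
      by_contra hne
      rw [(hs a ha).2.1 _ hcC hne, htz _ hcC] at h1
      exact lt_irrefl _ h1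
    rw [h2, htz a ha] at h1
    exact ⟨h2, h1⟩
  have hxz : ∀ b ∈ C, ψ b x = ψ b x := fun _ _ => rfl
  have hyz : ∀ b ∈ C, ψ b y = ψ b x := fun b hb => (hlab b hb).symm
  have snex : ∀ a ∈ C, s a ≠ x := fun a ha h => (hs a ha).2.2 (by rw [h])
  have sney : ∀ a ∈ C, s a ≠ y := fun a ha h => (hs a ha).2.2 (by rw [h, hyz a ha])
  have snev : ∀ a ∈ C, s a ≠ v := by
    intro a ha h
    have h1 := fromZ a ha x hx hxz (by rw [h]; exact hxv) (by rw [h]; exact hin x hx hxv)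
    have h2 := toZ a ha y hy hyz (by rw [h]; exact hvy) (by rw [h]; exact hout y hy hvy)
    omega
  have sinj : ∀ a ∈ C, ∀ b ∈ C, a ≠ b → s a ≠ s b := by
    intro a ha b hb hab h
    apply (hs a ha).2.2
    rw [h]
    exact (hs b hb).2.1 a ha hab
  have downdown : ∀ a ∈ C, ∀ b ∈ C, ψ b (s b) < ψ b x → s a < s b → c (s a) (s b) ∈ C →
      c (s a) (s b) = a := by
    intro a ha b hb hbd hlt hcC
    have h1 := hinc _ _ hlt
    by_contra hne
    rw [(hs a ha).2.1 _ hcC hne] at h1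
    by_cases hb' : c (s a) (s b) = b
    · rw [hb'] at h1
      omega
    · rw [(hs b hb).2.1 _ hcC hb'] at h1
      exact lt_irrefl _ h1
  have upup : ∀ a ∈ C, ∀ b ∈ C, ψ a x < ψ a (s a) → s a < s b → c (s a) (s b) ∈ C →
      c (s a) (s b) = b := by
    intro a ha b hb hbd hlt hcC
    have h1 := hinc _ _ hlt
    by_contra hne
    rw [(hs b hb).2.1 _ hcC hne] at h1
    by_cases hb' : c (s a) (s b) = a
    · rw [hb'] at h1
      omega
    · rw [(hs a ha).2.1 _ hcC hb'] at h1
      exact lt_irrefl _ h1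
  obtain ⟨u1, hu1, hu1'⟩ := pathDown (c := c) (V := V) s x hx (C.filter (fun a => s a < x))
    (by
      intro a ha
      rw [Finset.mem_filter] at ha
      exact ⟨(hs a ha.1).1, ha.2, (toZ a ha.1 x hx hxz ha.2 (same _ (hs a ha.1).1 _ hx ha.2
        (fun h => lt_asymm h.2 hxv))).1⟩)
    (by
      intro a ha b hb hab
      rw [Finset.mem_filter] at ha hb
      refine ⟨sinj a ha.1 b hb.1 hab, fun hlt => ?_⟩
      refine downdown a ha.1 b hb.1 ?_ hlt (same _ (hs a ha.1).1 _ (hs b hb.1).1 hlt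
        (fun h => lt_asymm (h.2.trans hb.2) hxv))
      exact (toZ b hb.1 x hx hxz hb.2 (same _ (hs b hb.1).1 _ hx hb.2
        (fun h => lt_asymm h.2 hxv))).2)
  obtain ⟨u2, hu2, hu2'⟩ := pathUp (c := c) (V := V) s x hx (C.filter (fun a => x < s a ∧ s a < v))
    (by
      intro a ha
      rw [Finset.mem_filter] at ha
      exact ⟨(hs a ha.1).1, ha.2.1, (fromZ a ha.1 x hx hxz ha.2.1 (same _ hx _ (hs a ha.1).1 ha.2.1
        (fun h => lt_asymm h.2 ha.2.2))).1⟩)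
    (by
      intro a ha b hb hab
      rw [Finset.mem_filter] at ha hb
      refine ⟨sinj a ha.1 b hb.1 hab, fun hlt => ?_⟩
      refine upup a ha.1 b hb.1 ?_ hlt (same _ (hs a ha.1).1 _ (hs b hb.1).1 hlt
        (fun h => lt_asymm h.2 hb.2.2))
      exact (fromZ a ha.1 x hx hxz ha.2.1 (same _ hx _ (hs a ha.1).1 ha.2.1
        (fun h => lt_asymm h.2 ha.2.2))).2)
  obtain ⟨u3, hu3, hu3'⟩ := pathDown (c := c) (V := V) s y hy
    (C.filter (fun a => v < s a ∧ s a < y))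
    (by
      intro a ha
      rw [Finset.mem_filter] at ha
      exact ⟨(hs a ha.1).1, ha.2.2, (toZ a ha.1 y hy hyz ha.2.2 (same _ (hs a ha.1).1 _ hy ha.2.2
        (fun h => lt_asymm h.1 ha.2.1))).1⟩)
    (by
      intro a ha b hb hab
      rw [Finset.mem_filter] at ha hb
      refine ⟨sinj a ha.1 b hb.1 hab, fun hlt => ?_⟩
      refine downdown a ha.1 b hb.1 ?_ hlt (same _ (hs a ha.1).1 _ (hs b hb.1).1 hlt
        (fun h => lt_asymm h.1 ha.2.1))
      exact (toZ b hb.1 y hy hyz hb.2.2 (same _ (hs b hb.1).1 _ hy hb.2.2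
        (fun h => lt_asymm h.1 hb.2.1))).2)
  obtain ⟨u4, hu4, hu4'⟩ := pathUp (c := c) (V := V) s y hy (C.filter (fun a => y < s a))
    (by
      intro a ha
      rw [Finset.mem_filter] at ha
      exact ⟨(hs a ha.1).1, ha.2, (fromZ a ha.1 y hy hyz ha.2 (same _ hy _ (hs a ha.1).1 ha.2
        (fun h => lt_asymm h.1 hvy))).1⟩)
    (by
      intro a ha b hb hab
      rw [Finset.mem_filter] at ha hb
      refine ⟨sinj a ha.1 b hb.1 hab, fun hlt => ?_⟩
      refine upup a ha.1 b hb.1 ?_ hlt (same _ (hs a ha.1).1 _ (hs b hb.1).1 hlt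
        (fun h => lt_asymm (ha.2.trans h.1) hvy))
      exact (fromZ a ha.1 y hy hyz ha.2 (same _ hy _ (hs a ha.1).1 ha.2
        (fun h => lt_asymm h.1 hvy))).2)
  have w2 : u2 < v ∧ ∀ b ∈ C, ψ b x ≤ ψ b u2 := by
    rcases hu2' with rfl | ⟨a, ha, rfl⟩
    · exact ⟨hxv, fun _ _ => le_rfl⟩
    · rw [Finset.mem_filter] at ha
      refine ⟨ha.2.2, fun b hb => ?_⟩
      by_cases hba : b = a
      · subst hba
        exact (fromZ b ha.1 x hx hxz ha.2.1 (same _ hx _ (hs b ha.1).1 ha.2.1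
          (fun h => lt_asymm h.2 ha.2.2))).2.le
      · exact ((hs a ha.1).2.1 b hb hba).ge
  have w3 : v < u3 ∧ ∀ b ∈ C, ψ b u3 ≤ ψ b x := by
    rcases hu3' with rfl | ⟨a, ha, rfl⟩
    · exact ⟨hvy, fun b hb => (hyz b hb).le⟩
    · rw [Finset.mem_filter] at ha
      refine ⟨ha.2.1, fun b hb => ?_⟩
      by_cases hba : b = a
      · subst hba
        exact (toZ b ha.1 y hy hyz ha.2.2 (same _ (hs b ha.1).1 _ hy ha.2.2
          (fun h => lt_asymm h.1 ha.2.1))).2.le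
      · exact ((hs a ha.1).2.1 b hb hba).le
  have w23 : u2 < u3 := w2.1.trans w3.1
  have hoC : c u2 u3 ∉ C := by
    intro h
    have h1 := hinc _ _ w23
    have h2 := w2.2 _ h
    have h3 := w3.2 _ h
    omega
  have hL := hu1.trans hu2 (by
    rw [Finset.disjoint_left]
    intro a ha hb
    rw [Finset.mem_filter] at ha hb
    exact lt_asymm ha.2 hb.2.1)
  have hR := hu3.trans hu4 (by
    rw [Finset.disjoint_left]
    intro a ha hb
    rw [Finset.mem_filter] at ha hb
    exact lt_asymm ha.2.2 hb.2)
  have hL' := Rb.snoc hL hR.mem_left w23 (by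
    intro h
    simp only [Finset.mem_union, Finset.mem_filter] at h
    exact hoC (h.elim And.left And.left))
  have hA := hL'.trans hR (by
    rw [Finset.disjoint_left]
    intro a ha hb
    simp only [Finset.mem_insert, Finset.mem_union, Finset.mem_filter] at ha hb
    rcases ha with rfl | ha
    · exact hoC (hb.elim And.left And.left)
    have h1 : v < s a := by
      rcases hb with hb | hb
      · exact hb.2.1
      · exact hvy.trans hb.2
    have h2 : s a < v := by
      rcases ha with ha | ha
      · exact ha.2.trans hxv
      · exact ha.2.2
    exact lt_asymm h1 h2)
  have hcard := hV _ _ _ hA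
  have hsub : insert (c u2 u3) C ⊆ insert (c u2 u3)
      (C.filter (fun a => s a < x) ∪ C.filter (fun a => x < s a ∧ s a < v)) ∪
      (C.filter (fun a => v < s a ∧ s a < y) ∪ C.filter (fun a => y < s a)) := by
    intro a ha
    rw [Finset.mem_insert] at ha
    simp only [Finset.mem_insert, Finset.mem_union, Finset.mem_filter]
    rcases ha with ha | ha
    · exact Or.inl (Or.inl ha)
    rcases lt_or_gt_of_ne (snex a ha) with h | h
    · exact Or.inl (Or.inr (Or.inl ⟨ha, h⟩))
    rcases lt_or_gt_of_ne (snev a ha) with h' | h'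
    · exact Or.inl (Or.inr (Or.inr ⟨ha, h, h'⟩))
    rcases lt_or_gt_of_ne (sney a ha) with h'' | h''
    · exact Or.inr (Or.inl ⟨ha, h', h''⟩)
    · exact Or.inr (Or.inr ⟨ha, h''⟩)
  have := Finset.card_le_card hsub
  rw [Finset.card_insert_of_notMem hoC] at this
  omega

/-- The strong vertex lemma. -/
theorem strong_card {m l : ℕ} (hm : 1 ≤ m) (hl : m + 1 ≤ l)
    (hV : NoRb (· < ·) c V m) {v : ι} (hv : v ∈ V) {C : Finset α}
    (hC : C.card = m) (ψ : α → ι → ℕ) (hψ : ∀ a v, ψ a v < l)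
    (hinc : ∀ u v, u < v → ψ (c u v) u < ψ (c u v) v)
    (hin : ∀ u ∈ V, u < v → c u v ∈ C) (hout : ∀ u ∈ V, v < u → c v u ∈ C)
    (hrin : ∀ a ∈ C, ∃ u S, Rb (· < ·) c V u v S ∧ a ∉ S ∧ S.card + 1 = m ∧ S ⊆ C)
    (hrout : ∀ a ∈ C, ∃ u S, Rb (· < ·) c V v u S ∧ a ∉ S ∧ S.card + 1 = m ∧ S ⊆ C) :
    V.card ≤ l ^ m := by
  classical
  have side : ∀ p ∈ V, ∀ q ∈ V, p < q → c p q ∉ C → p < v ∧ v < q :=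
    fun p hp q hq hpq hc => strong_side hV hC hin hout hrin hrout hp hq hpq hc
  set Λ : ι → (C → Fin l) := fun p a => ⟨ψ a p, hψ _ _⟩ with hΛ
  have Λeq : ∀ p q, Λ p = Λ q ↔ ∀ a ∈ C, ψ a p = ψ a q := by
    intro p q
    rw [funext_iff]
    constructor
    · intro h a ha
      have := h ⟨a, ha⟩
      simpa [hΛ] using this
    · intro h a
      simp [hΛ, h a a.2]
  set Y := V.filter (fun y => ∃ x ∈ V, x < y ∧ Λ x = Λ y) with hY
  set Occ := V.image Λ with hOcc
  have pairside : ∀ x ∈ V, ∀ y ∈ V, x < y → Λ x = Λ y → x < v ∧ v < y := by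
    intro x hx y hy hxy h
    refine side x hx y hy hxy (fun h' => ?_)
    have := hinc _ _ hxy
    rw [(Λeq x y).1 h _ h'] at this
    exact lt_irrefl _ this
  have inj1 : Set.InjOn Λ ↑(V \ Y) := by
    intro p hp q hq hpq
    have hp' : p ∈ V \ Y := hp
    have hq' : q ∈ V \ Y := hq
    rw [Finset.mem_sdiff, hY, Finset.mem_filter] at hp' hq'
    by_contra hne
    rcases lt_or_gt_of_ne hne with h | h
    · exact hq'.2 ⟨hq'.1, p, hp'.1, h, hpq⟩
    · exact hp'.2 ⟨hp'.1, q, hq'.1, h, hpq.symm⟩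
  have hYmem : ∀ y ∈ Y, y ∈ V ∧ ∃ x ∈ V, x < y ∧ Λ x = Λ y := by
    intro y hy
    rwa [hY, Finset.mem_filter] at hy
  have inj2 : Set.InjOn Λ ↑Y := by
    have aux : ∀ p ∈ Y, ∀ q ∈ Y, Λ p = Λ q → ¬ p < q := by
      intro p hp q hq hpq hlt
      obtain ⟨hp1, x, hx, hxp, hxl⟩ := hYmem p hp
      have h1 := pairside x hx p hp1 hxp hxl
      have h2 := pairside p hp1 q (hYmem q hq).1 hlt hpq
      exact lt_asymm h1.2 h2.1
    intro p hp q hq hpq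
    by_contra hne
    rcases lt_or_gt_of_ne hne with h | h
    · exact aux p hp q hq hpq h
    · exact aux q hq p hp hpq.symm h
  have hfree : ∀ y ∈ Y, ∃ a : C, ∀ p ∈ V, (∀ b, b ≠ a → Λ p b = Λ y b) → Λ p = Λ y := by
    intro y hy
    obtain ⟨hy1, x, hx, hxy, hxl⟩ := hYmem y hy
    obtain ⟨a, ha, h⟩ := line_free hV hv hC ψ hinc hin hout side hx hy1 hxy ((Λeq x y).1 hxl)
    refine ⟨⟨a, ha⟩, fun p hp hb => ?_⟩
    rw [← hxl] at hb ⊢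
    have hb' : ∀ b ∈ C, b ≠ a → ψ b p = ψ b x := by
      intro b hbC hba
      have := hb ⟨b, hbC⟩ (fun h => hba (congrArg Subtype.val h))
      simpa [hΛ] using this
    rw [Λeq]
    intro b hbC
    by_cases hba : b = a
    · rw [hba]
      exact h p hp hb'
    · exact hb' b hbC hba
  obtain ⟨a0, ha0⟩ : C.Nonempty := Finset.card_pos.1 (by omega)
  have : Nonempty C := ⟨⟨a0, ha0⟩⟩
  choose! A hA using hfree
  have hcount : Y.card * (l - 1) ≤ Occᶜ.card * m := by
    refine Finset.card_mul_le_card_mul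
      (fun y w => w ≠ Λ y ∧ ∀ b, b ≠ A y → w b = Λ y b) ?_ ?_
    · intro y hy
      have : ((Finset.univ.erase (Λ y (A y))).image (fun j => Function.update (Λ y) (A y) j)).card
          = l - 1 := by
        rw [Finset.card_image_of_injective _ (Function.update_injective _ _)]
        simp
      rw [← this]
      refine Finset.card_le_card ?_
      intro w hw
      rw [Finset.mem_image] at hw
      obtain ⟨j, hj, rfl⟩ := hw
      have hj' := Finset.ne_of_mem_erase hj
      have hne : Function.update (Λ y) (A y) j ≠ Λ y := by
        intro h
        apply hj'
        have := congrFun h (A y)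
        simpa using this
      rw [Finset.mem_bipartiteAbove]
      refine ⟨?_, hne, fun b hb => Function.update_of_ne hb _ _⟩
      rw [Finset.mem_compl, hOcc, Finset.mem_image]
      rintro ⟨p, hp, hpe⟩
      apply hne
      rw [← hpe]
      refine hA y hy p hp (fun b hb => ?_)
      rw [hpe]
      exact Function.update_of_ne hb _ _
    · intro w hw
      have : m = (Finset.univ : Finset C).card := by simp [hC]
      rw [this]
      refine Finset.card_le_card_of_injOn A (fun _ _ => Finset.mem_univ _) ?_
      intro y hy y' hy' hAA
      rw [Finset.mem_coe, Finset.mem_bipartiteBelow] at hy hy'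
      refine inj2 hy.1 hy'.1 ?_
      refine (hA y' hy'.1 y (hYmem y hy.1).1 (fun b hb => ?_))
      rw [← hy'.2.2 b hb, ← hy.2.2 b (by rw [hAA]; exact hb)]
  have hY2 : Y.card ≤ Occᶜ.card := by
    have h1 : Y.card * m ≤ Y.card * (l - 1) := Nat.mul_le_mul_left _ (by omega)
    exact Nat.le_of_mul_le_mul_right (h1.trans hcount) (by omega)
  have hV2 : (V \ Y).card ≤ Occ.card := by
    rw [← Finset.card_image_of_injOn inj1]
    exact Finset.card_le_card (Finset.image_subset_image Finset.sdiff_subset)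
  have hsplit : (V \ Y).card + Y.card = V.card :=
    Finset.card_sdiff_add_card_eq_card (Finset.filter_subset _ _)
  have htot : Occ.card + Occᶜ.card = l ^ m := by
    rw [Finset.card_add_card_compl]
    simp [hC]
  omega

end FlashStrong

section FlashMain

variable {ι α : Type} [LinearOrder ι] {c : ι → ι → α} {V : Finset ι}

theorem in_mem {m : ℕ} (hV : NoRb (· < ·) c V m) {u v w : ι} {S : Finset α}
    (h : Rb (· < ·) c V v w S) (hS : S.card = m) (hu : u ∈ V) (hl : u < v) : c u v ∈ S :=
  out_mem (lt := fun a b => b < a) (c := fun a b => c b a) hV.dual h.dual hS hu hl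

theorem box_card {l : ℕ} (ψ : α → ι → ℕ) (hψ : ∀ a v, ψ a v < l)
    (hinc : ∀ u v, u < v → ψ (c u v) u < ψ (c u v) v) (W : Finset ι) (T : Finset α)
    (h : ∀ p ∈ W, ∀ q ∈ W, p < q → c p q ∈ T) : W.card ≤ l ^ T.card := by
  classical
  have h1 : (Finset.univ : Finset (T → Fin l)).card = l ^ T.card := by simp
  rw [← h1]
  refine Finset.card_le_card_of_injOn (fun p a => ⟨ψ a p, hψ _ _⟩) (fun _ _ => by simp) ?_
  have aux : ∀ p ∈ W, ∀ q ∈ W, p < q →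
      (fun a : T => (⟨ψ a p, hψ _ _⟩ : Fin l)) ≠ fun a : T => ⟨ψ a q, hψ _ _⟩ := by
    intro p hp q hq hpq he
    have h2 := congrFun he ⟨c p q, h p hp q hq hpq⟩
    simp only [Fin.mk.injEq] at h2
    have := hinc _ _ hpq
    omega
  intro p hp q hq he
  by_contra hne
  rcases lt_or_gt_of_ne hne with h' | h'
  · exact aux p hp q hq h' he
  · exact aux q hq p hp h' he.symm

open Classical in
/-- vertices of `W` seeing every colour of `T` on both sides inside `W` -/
noncomputable def fullSet (c : ι → ι → α) (W : Finset ι) (T : Finset α) : Finset ι :=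
  W.filter (fun v => ∀ a ∈ T, (∃ u ∈ W, u < v ∧ c u v = a) ∧ (∃ u ∈ W, v < u ∧ c v u = a))

theorem fullSet_subset (W : Finset ι) (T : Finset α) : fullSet c W T ⊆ W := by
  classical
  unfold fullSet
  exact Finset.filter_subset _ _

theorem card_fullSet {l : ℕ} (ψ : α → ι → ℕ) (hψ : ∀ a v, ψ a v < l)
    (hinc : ∀ u v, u < v → ψ (c u v) u < ψ (c u v) v) (W : Finset ι) (T : Finset α)
    (h : ∀ p ∈ W, ∀ q ∈ W, p < q → c p q ∈ T) :
    W.card ≤ (fullSet c W T).card + T.card * (2 * l ^ (T.card - 1)) := by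
  classical
  have hsub : W ⊆ fullSet c W T ∪ T.biUnion (fun a =>
      W.filter (fun v => ¬ ∃ u ∈ W, u < v ∧ c u v = a) ∪
      W.filter (fun v => ¬ ∃ u ∈ W, v < u ∧ c v u = a)) := by
    intro v hv
    by_cases hf : v ∈ fullSet c W T
    · exact Finset.mem_union_left _ hf
    refine Finset.mem_union_right _ ?_
    rw [fullSet, Finset.mem_filter] at hf
    have hf' : ¬ ∀ a ∈ T, (∃ u ∈ W, u < v ∧ c u v = a) ∧ (∃ u ∈ W, v < u ∧ c v u = a) :=
      fun h' => hf ⟨hv, h'⟩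
    rw [not_forall] at hf'
    obtain ⟨a, ha⟩ := hf'
    rw [Classical.not_imp, not_and_or] at ha
    rw [Finset.mem_biUnion]
    refine ⟨a, ha.1, ?_⟩
    rw [Finset.mem_union, Finset.mem_filter, Finset.mem_filter]
    rcases ha.2 with h' | h'
    · exact Or.inl ⟨hv, h'⟩
    · exact Or.inr ⟨hv, h'⟩
  refine (Finset.card_le_card hsub).trans ((Finset.card_union_le _ _).trans ?_)
  refine Nat.add_le_add_left (Finset.card_biUnion_le_card_mul _ _ _ ?_) _
  intro a ha
  refine (Finset.card_union_le _ _).trans ?_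
  rw [two_mul, ← Finset.card_erase_of_mem ha]
  refine Nat.add_le_add ?_ ?_
  · refine box_card ψ hψ hinc _ _ ?_
    intro p hp q hq hpq
    rw [Finset.mem_filter] at hp hq
    rw [Finset.mem_erase]
    exact ⟨fun he => hq.2 ⟨p, hp.1, hpq, he⟩, h p hp.1 q hq.1 hpq⟩
  · refine box_card ψ hψ hinc _ _ ?_
    intro p hp q hq hpq
    rw [Finset.mem_filter] at hp hq
    rw [Finset.mem_erase]
    exact ⟨fun he => hp.2 ⟨q, hq.1, hpq, he⟩, h p hp.1 q hq.1 hpq⟩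

theorem main_step {m l : ℕ} (hm : 1 ≤ m) (hl : 20 * m ^ 3 ≤ l)
    (ψ : α → ι → ℕ) (hψ : ∀ a v, ψ a v < l)
    (hinc : ∀ u v, u < v → ψ (c u v) u < ψ (c u v) v)
    (IH : ∀ j < m, ∀ W : Finset ι, NoRb (· < ·) c W j → W.card ≤ l ^ j)
    (hV : NoRb (· < ·) c V m) : V.card ≤ l ^ m := by
  classical
  have hm3 : m ≤ m ^ 3 := Nat.le_self_pow (by omega) m
  have hl1 : 1 ≤ l := by omega
  have hq : 1 ≤ l ^ (m - 1) := Nat.one_le_pow _ _ hl1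
  have hB1 : (badIn (· < ·) c V m).card ≤ l ^ (m - 1) + m * (1 + m * (m * l ^ (m - 1))) := by
    refine card_badIn m l hm hl1 ψ hψ (fun u v h => (hinc u v h).ne) ?_ IH hV
    intro W hW
    exact ⟨W.min' hW, W.min'_mem hW, fun v hv hne => lt_of_le_of_ne (W.min'_le v hv) hne.symm⟩
  have hB2 : (badIn (fun a b => b < a) (fun a b => c b a) V m).card ≤
      l ^ (m - 1) + m * (1 + m * (m * l ^ (m - 1))) := by
    refine card_badIn m l hm hl1 ψ hψ (fun u v h => (hinc v u h).ne') ?_ ?_ hV.dual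
    · intro W hW
      exact ⟨W.max' hW, W.max'_mem hW, fun v hv hne => lt_of_le_of_ne (W.le_max' v hv) hne⟩
    · intro j hj W hW
      exact IH j hj W hW.dual
  set A0 := V \ (badIn (· < ·) c V m ∪ badIn (fun a b => b < a) (fun a b => c b a) V m) with hA0
  have hA0V : A0 ⊆ V := Finset.sdiff_subset
  have hVA : V.card ≤ A0.card + ((badIn (· < ·) c V m).card +
      (badIn (fun a b => b < a) (fun a b => c b a) V m).card) := by
    have h1 := Finset.card_le_card_sdiff_add_card (s := V)
      (t := badIn (· < ·) c V m ∪ badIn (fun a b => b < a) (fun a b => c b a) V m)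
    have h2 := Finset.card_union_le (badIn (· < ·) c V m)
      (badIn (fun a b => b < a) (fun a b => c b a) V m)
    rw [← hA0] at h1
    omega
  have hA0in : ∀ v ∈ A0, (∃ u S, Rb (· < ·) c V u v S ∧ S.card = m) ∧
      InRob (· < ·) c V (m - 1) v := by
    intro v hv
    by_contra hcon
    rw [hA0, Finset.mem_sdiff, Finset.mem_union, not_or] at hv
    apply hv.2.1
    rw [badIn, Finset.mem_filter]
    exact ⟨hv.1, hcon⟩
  have hA0out : ∀ v ∈ A0, ∀ a, ∃ u S, Rb (· < ·) c V v u S ∧ S.card = m - 1 ∧ a ∉ S := by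
    intro v hv a
    have : InRob (fun a b => b < a) (fun a b => c b a) V (m - 1) v := by
      by_contra hcon
      rw [hA0, Finset.mem_sdiff, Finset.mem_union, not_or] at hv
      apply hv.2.2
      rw [badIn, Finset.mem_filter]
      exact ⟨hv.1, fun h => hcon h.2⟩
    obtain ⟨u, S, hS, h1, h2⟩ := this a
    exact ⟨u, S, hS.dual, h1, h2⟩
  have hfinal : A0.card ≤ 1 + m * (4 * m * l ^ (m - 1)) → V.card ≤ l ^ m := by
    intro h
    have h1 : l ^ m = l * l ^ (m - 1) := by
      rw [← pow_succ']
      congr 1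
      omega
    rw [h1]
    refine le_trans ?_ (Nat.mul_le_mul_right _ hl)
    set q := l ^ (m - 1)
    have hmm : m ≤ m ^ 2 := Nat.le_self_pow (by omega) m
    have hmm3 : m ^ 2 ≤ m ^ 3 := Nat.pow_le_pow_right hm (by omega)
    have e1 : m * q ≤ m ^ 3 * q := Nat.mul_le_mul_right _ hm3
    have e2 : m ^ 2 * q ≤ m ^ 3 * q := Nat.mul_le_mul_right _ hmm3
    have e3 : q ≤ m * q := Nat.le_mul_of_pos_left _ hm
    have e4 : m ≤ m * q := Nat.le_mul_of_pos_right _ hq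
    have e5 : m * (1 + m * (m * q)) = m + m ^ 3 * q := by ring
    have e6 : m * (4 * m * q) = 4 * (m ^ 2 * q) := by ring
    have e7 : 20 * m ^ 3 * q = 20 * (m ^ 3 * q) := by ring
    rw [e5] at hB1 hB2
    rw [e6] at h
    rw [e7]
    omega
  rcases A0.eq_empty_or_nonempty with he | hne
  · apply hfinal
    rw [he]
    simp
  set x := A0.min' hne with hx
  have hxA : x ∈ A0 := A0.min'_mem hne
  obtain ⟨⟨u0, S0, hS0, hS0c⟩, hrob⟩ := hA0in x hxA
  choose p R hR hRc hRa using hrob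
  set Vd : α → Finset ι := fun d => A0.filter (fun v => x < v ∧ c x v = d) with hVd
  have hVdmem : ∀ d, ∀ v ∈ Vd d, v ∈ A0 ∧ x < v ∧ c x v = d := by
    intro d v hv
    simpa [hVd] using hv
  by_cases hbig : ∃ d ∈ S0, 4 * m * l ^ (m - 1) < (Vd d).card
  swap
  · apply hfinal
    push Not at hbig
    have hsub : A0 ⊆ {x} ∪ S0.biUnion Vd := by
      intro v hv
      by_cases hvx : v = x
      · simp [hvx]
      have hlt : x < v := lt_of_le_of_ne (A0.min'_le v hv) (Ne.symm hvx)
      refine Finset.mem_union_right _ ?_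
      rw [Finset.mem_biUnion]
      refine ⟨c x v, out_mem hV hS0 hS0c (hA0V hv) hlt, ?_⟩
      rw [hVd, Finset.mem_filter]
      exact ⟨hv, hlt, rfl⟩
    refine (Finset.card_le_card hsub).trans ((Finset.card_union_le _ _).trans ?_)
    rw [Finset.card_singleton]
    refine Nat.add_le_add_left ?_ 1
    have := Finset.card_biUnion_le_card_mul S0 Vd _ hbig
    rwa [hS0c] at this
  obtain ⟨d, hd, hdbig⟩ := hbig
  set T := insert d (R d) with hT
  have hTc : T.card = m := by
    rw [hT, Finset.card_insert_of_notMem (hRa d), hRc]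
    omega
  have houtT : ∀ v ∈ Vd d, ∀ u ∈ V, v < u → c v u ∈ T := by
    intro v hv u hu hvu
    obtain ⟨h1, h2, h3⟩ := hVdmem d v hv
    have h4 := Rb.snoc (hR d) (hA0V h1) h2 (by rw [h3]; exact hRa d)
    rw [h3] at h4
    exact out_mem hV h4 hTc hu hvu
  have hVdV : Vd d ⊆ V := fun v hv => hA0V (hVdmem d v hv).1
  have hcol : ∀ p ∈ Vd d, ∀ q ∈ Vd d, p < q → c p q ∈ T :=
    fun p hp q hq hpq => houtT p hp q (hVdV hq) hpq
  set A1 := fullSet c (Vd d) T with hA1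
  have hA1V : A1 ⊆ Vd d := fullSet_subset _ _
  have hc1 := card_fullSet ψ hψ hinc (Vd d) T hcol
  have hc2 := card_fullSet ψ hψ hinc A1 T (fun p hp q hq => hcol p (hA1V hp) q (hA1V hq))
  have hne2 : (fullSet c A1 T).Nonempty := by
    rw [← Finset.card_pos]
    rw [← hA1, hTc] at hc1
    rw [hTc] at hc2
    have e1 : 4 * m * l ^ (m - 1) = 4 * (m * l ^ (m - 1)) := by ring
    have e2 : m * (2 * l ^ (m - 1)) = 2 * (m * l ^ (m - 1)) := by ring
    rw [e1] at hdbig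
    rw [e2] at hc1 hc2
    omega
  obtain ⟨v, hv⟩ := hne2
  have hvA1 : v ∈ A1 := fullSet_subset _ _ hv
  have hfull1 : ∀ w ∈ A1, ∀ a ∈ T, (∃ u ∈ Vd d, u < w ∧ c u w = a) ∧
      (∃ u ∈ Vd d, w < u ∧ c w u = a) := by
    intro w hw
    rw [hA1, fullSet, Finset.mem_filter] at hw
    exact hw.2
  have hfull2 : ∀ a ∈ T, (∃ u ∈ A1, u < v ∧ c u v = a) ∧ (∃ u ∈ A1, v < u ∧ c v u = a) := by
    rw [fullSet, Finset.mem_filter] at hv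
    exact hv.2
  have hvV : v ∈ V := hVdV (hA1V hvA1)
  have hA1A0 : ∀ w ∈ A1, w ∈ A0 := fun w hw => (hVdmem d w (hA1V hw)).1
  have eqOut : ∀ w ∈ A1, ∀ u D, Rb (· < ·) c V u w D → D.card = m → D = T := by
    intro w hw u D hD hDc
    refine (Finset.eq_of_subset_of_card_le (fun a ha => ?_) (by rw [hDc, hTc])).symm
    obtain ⟨-, y, hy, hwy, rfl⟩ := hfull1 w hw a ha
    exact out_mem hV hD hDc (hVdV hy) hwy
  have eqIn : ∀ w ∈ A1, ∀ u D, Rb (· < ·) c V w u D → D.card = m → D = T := by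
    intro w hw u D hD hDc
    refine (Finset.eq_of_subset_of_card_le (fun a ha => ?_) (by rw [hDc, hTc])).symm
    obtain ⟨⟨y, hy, hwy, rfl⟩, -⟩ := hfull1 w hw a ha
    exact in_mem hV hD hDc (hVdV hy) hwy
  refine strong_card hm (by omega) hV hvV hTc ψ hψ hinc ?_ (houtT v (hA1V hvA1)) ?_ ?_
  · intro u hu huv
    obtain ⟨-, w, hw, hvw, hcw⟩ := hfull2 d (Finset.mem_insert_self _ _)
    obtain ⟨y, D, hD, hDc, hDa⟩ := hA0out w (hA1A0 w hw) d
    have h1 := Rb.cons (lt := (· < ·)) hvV hvw hD (by rw [hcw]; exact hDa)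
    rw [hcw] at h1
    have h2 : (insert d D).card = m := by
      rw [Finset.card_insert_of_notMem hDa]
      omega
    rw [← eqIn v hvA1 _ _ h1 h2]
    exact in_mem hV h1 h2 hu huv
  · intro a ha
    obtain ⟨-, w, hw, hvw, hcw⟩ := hfull2 a ha
    obtain ⟨y, D, hD, hDc, hDa⟩ := (hA0in v (hA1A0 v hvA1)).2 a
    have h1 := Rb.snoc hD (hVdV (hA1V hw)) hvw (by rw [hcw]; exact hDa)
    rw [hcw] at h1
    have h2 := eqOut w hw _ _ h1 (by
      rw [Finset.card_insert_of_notMem hDa]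
      omega)
    refine ⟨y, D, hD, hDa, by omega, ?_⟩
    rw [← h2]
    exact Finset.subset_insert _ _
  · intro a ha
    obtain ⟨⟨w, hw, hwv, hcw⟩, -⟩ := hfull2 a ha
    obtain ⟨y, D, hD, hDc, hDa⟩ := hA0out v (hA1A0 v hvA1) a
    have h1 := Rb.cons (lt := (· < ·)) (hVdV (hA1V hw)) hwv hD (by rw [hcw]; exact hDa)
    rw [hcw] at h1
    have h2 := eqIn w hw _ _ h1 (by
      rw [Finset.card_insert_of_notMem hDa]
      omega)
    refine ⟨y, D, hD, hDa, by omega, ?_⟩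
    rw [← h2]
    exact Finset.subset_insert _ _

theorem main_card {l : ℕ} (ψ : α → ι → ℕ) (hψ : ∀ a v, ψ a v < l)
    (hinc : ∀ u v, u < v → ψ (c u v) u < ψ (c u v) v) (m : ℕ) :
    20 * m ^ 3 ≤ l → ∀ W : Finset ι, NoRb (· < ·) c W m → W.card ≤ l ^ m := by
  induction m using Nat.strong_induction_on with
  | _ m ih =>
    intro hl W hW
    rcases Nat.eq_zero_or_pos m with rfl | hm
    · rw [pow_zero, Finset.card_le_one]
      have aux : ∀ a ∈ W, ∀ b ∈ W, ¬ a < b := by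
        intro a ha b hb hab
        have := hW _ _ _ (Rb.snoc (Rb.refl ha) hb hab (by simp))
        simp at this
      intro a ha b hb
      exact le_antisymm (not_lt.1 (aux b hb a ha)) (not_lt.1 (aux a ha b hb))
    · refine main_step hm hl ψ hψ hinc (fun j hj => ih j hj ?_) hW
      refine le_trans ?_ hl
      gcongr

end FlashMain

section FlashTop

theorem snocWalk {n j : ℕ} {α : Type} (c : Fin n → Fin n → α) (x : Fin (j + 1) → Fin n) (v : Fin n)
    (hx : StrictMono x) (hv : x (Fin.last j) < v) :
    StrictMono (Fin.snoc x v : Fin (j + 1 + 1) → Fin n) ∧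
    (∀ i : Fin j, walkColours c (Fin.snoc x v : Fin (j + 1 + 1) → Fin n) i.castSucc
      = walkColours c x i) ∧
    walkColours c (Fin.snoc x v : Fin (j + 1 + 1) → Fin n) (Fin.last j) = c (x (Fin.last j)) v := by
  have e1 : ∀ i : Fin j, (Fin.snoc x v : Fin (j + 1 + 1) → Fin n) i.castSucc.succ = x i.succ := by
    intro i
    rw [Fin.succ_castSucc]
    exact Fin.snoc_castSucc (α := fun _ => Fin n) v x i.succ
  have e2 : ∀ i : Fin (j + 1), (Fin.snoc x v : Fin (j + 1 + 1) → Fin n) i.castSucc = x i :=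
    fun i => Fin.snoc_castSucc (α := fun _ => Fin n) v x i
  have e3 : (Fin.snoc x v : Fin (j + 1 + 1) → Fin n) (Fin.last j).succ = v := by
    rw [Fin.succ_last]
    exact Fin.snoc_last (α := fun _ => Fin n) v x
  refine ⟨?_, ?_, ?_⟩
  · rw [Fin.strictMono_iff_lt_succ]
    intro i
    induction i using Fin.lastCases with
    | last => rw [e2, e3]; exact hv
    | cast i => rw [e2, e1]; exact hx Fin.castSucc_lt_succ
  · intro i
    unfold walkColours
    rw [e2, e1]
  · unfold walkColours
    rw [e2, e3]

theorem rb_walk {n : ℕ} {α : Type} {c : Fin n → Fin n → α} {V : Finset (Fin n)} {u v : Fin n}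
    {S : Finset α} (h : Rb (· < ·) c V u v S) : ∀ j, S.card = j →
    ∃ y : Fin (j + 1) → Fin n, StrictMono y ∧ Function.Injective (walkColours c y) ∧
      (∀ i, walkColours c y i ∈ S) ∧ y (Fin.last j) = v := by
  classical
  induction h with
  | refl hv =>
    intro j hj
    rw [Finset.card_empty] at hj
    subst hj
    exact ⟨fun _ => u, fun i i' hii => by omega, fun i => i.elim0, fun i => i.elim0, rfl⟩
  | @snoc v w S h1 hw hl hc ih =>
    intro j hj
    rw [Finset.card_insert_of_notMem hc] at hj
    subst hj
    obtain ⟨y, hy, hinj, hS, hlast⟩ := ih _ rfl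
    obtain ⟨g1, g2, g3⟩ := snocWalk c y w hy (by rw [hlast]; exact hl)
    rw [hlast] at g3
    refine ⟨Fin.snoc y w, g1, ?_, ?_, Fin.snoc_last (α := fun _ => Fin n) w y⟩
    · intro i i' hii
      induction i using Fin.lastCases with
      | last =>
        induction i' using Fin.lastCases with
        | last => rfl
        | cast i' =>
          rw [g2, g3] at hii
          exact absurd (hii ▸ hS i') hc
      | cast i =>
        induction i' using Fin.lastCases with
        | last =>
          rw [g2, g3] at hii
          exact absurd (hii ▸ hS i) hc
        | cast i' =>
          rw [g2, g2] at hii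
          rw [hinj hii]
    · intro i
      induction i using Fin.lastCases with
      | last => rw [g3]; exact Finset.mem_insert_self _ _
      | cast i => rw [g2]; exact Finset.mem_insert_of_mem (hS i)

/-- there is a flash of colour `a` and length `j` ending at `v` -/
def FlEnd {n : ℕ} {α : Type} (c : Fin n → Fin n → α) (a : α) (v : Fin n) (j : ℕ) : Prop :=
  ∃ x : Fin (j + 1) → Fin n, StrictMono x ∧ (∀ i, walkColours c x i = a) ∧ x (Fin.last j) = v

theorem exists_labels {n l : ℕ} {α : Type} (hl : 0 < l) (c : Fin n → Fin n → α)
    (h : ¬ HasMonoFlash l c) :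
    ∃ ψ : α → Fin n → ℕ, (∀ a v, ψ a v < l) ∧
      ∀ u v, u < v → ψ (c u v) u < ψ (c u v) v := by
  classical
  refine ⟨fun a v => Nat.findGreatest (FlEnd c a v) (l - 1), fun a v => ?_, fun u v huv => ?_⟩
  · exact lt_of_le_of_lt (Nat.findGreatest_le (P := FlEnd c a v) (l - 1)) (by omega)
  · set a := c u v with ha
    have h0 : FlEnd c a u 0 :=
      ⟨fun _ => u, fun i i' hii => by omega, fun i => i.elim0, rfl⟩
    have h1 : FlEnd c a u (Nat.findGreatest (FlEnd c a u) (l - 1)) :=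
      Nat.findGreatest_spec (Nat.zero_le _) h0
    have hle := Nat.findGreatest_le (P := FlEnd c a u) (l - 1)
    have h2 : FlEnd c a v (Nat.findGreatest (FlEnd c a u) (l - 1) + 1) := by
      obtain ⟨x, hx, hxa, hxl⟩ := h1
      obtain ⟨g1, g2, g3⟩ := snocWalk c x v hx (by rw [hxl]; exact huv)
      refine ⟨Fin.snoc x v, g1, ?_, Fin.snoc_last (α := fun _ => Fin n) v x⟩
      intro i
      induction i using Fin.lastCases with
      | last => rw [g3, hxl]
      | cast i => rw [g2]; exact hxa i
    show Nat.findGreatest (FlEnd c a u) (l - 1) < Nat.findGreatest (FlEnd c a v) (l - 1)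
    refine Nat.lt_of_succ_le (Nat.le_findGreatest ?_ h2)
    by_contra hgt
    have he : Nat.findGreatest (FlEnd c a u) (l - 1) + 1 = l := by omega
    rw [he] at h2
    obtain ⟨x, hx, hxa, -⟩ := h2
    exact h ⟨x, hx, fun i j => by rw [hxa, hxa]⟩

theorem upper_mem {l k : ℕ} (hl : 0 < l) (hk : 0 < k) (h : 20 * (k - 1) ^ 3 ≤ l) :
    l ^ (k - 1) ∈ fSet l k := by
  intro n hn α c
  by_contra hcon
  rw [not_or] at hcon
  obtain ⟨ψ, hψ, hinc⟩ := exists_labels hl c hcon.1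
  have hno : NoRb (· < ·) c (Finset.univ : Finset (Fin n)) (k - 1) := by
    intro u v S hS
    by_contra hgt
    obtain ⟨w, T, hT, hTc⟩ := hS.trunc k (by omega)
    obtain ⟨y, hy, hinj, -, -⟩ := rb_walk hT k hTc
    exact hcon.2 ⟨y, hy, hinj⟩
  have := main_card ψ hψ hinc (k - 1) h _ hno
  rw [Finset.card_univ, Fintype.card_fin] at this
  omega

/-- the lexicographic colouring -/
def lexCol (l K u v : ℕ) : ℕ := Nat.findGreatest (fun i => u / l ^ i ≠ v / l ^ i) K

theorem lexCol_spec {l K u v : ℕ} (huv : u < v) (hv : v < l ^ K) :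
    lexCol l K u v < K ∧ u / l ^ lexCol l K u v < v / l ^ lexCol l K u v ∧
      u / l ^ (lexCol l K u v + 1) = v / l ^ (lexCol l K u v + 1) := by
  have h1 : u / l ^ lexCol l K u v ≠ v / l ^ lexCol l K u v :=
    Nat.findGreatest_spec (P := fun i => u / l ^ i ≠ v / l ^ i) (Nat.zero_le K)
      (by simpa using huv.ne)
  have h2 : lexCol l K u v ≤ K := Nat.findGreatest_le _
  have h3 : lexCol l K u v ≠ K := by
    intro h
    rw [h, Nat.div_eq_of_lt hv, Nat.div_eq_of_lt (huv.trans hv)] at h1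
    exact h1 rfl
  have h4 : lexCol l K u v < K := lt_of_le_of_ne h2 h3
  refine ⟨h4, lt_of_le_of_ne (Nat.div_le_div_right huv.le) h1, ?_⟩
  have := Nat.findGreatest_is_greatest (P := fun i => u / l ^ i ≠ v / l ^ i) (n := K)
    (k := lexCol l K u v + 1) (Nat.lt_succ_self _) h4
  simpa using this

theorem lower_bd {l k : ℕ} (hl : 0 < l) (hk : 0 < k) (b : ℕ) (hb : b ∈ fSet l k) :
    l ^ (k - 1) ≤ b := by
  by_contra hlt
  rcases hb (l ^ (k - 1)) (by omega) ℕ (fun u v => lexCol l (k - 1) u v) with h | h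
  · obtain ⟨x, hx, hc⟩ := h
    set i := lexCol l (k - 1) (x (Fin.castSucc ⟨0, hl⟩)) (x (Fin.succ ⟨0, hl⟩)) with hi
    have hstep : ∀ j (hj : j < l),
        (x ⟨j, by omega⟩ : ℕ) / l ^ i < (x ⟨j + 1, by omega⟩ : ℕ) / l ^ i ∧
        (x ⟨j, by omega⟩ : ℕ) / l ^ (i + 1) = (x ⟨j + 1, by omega⟩ : ℕ) / l ^ (i + 1) := by
      intro j hj
      have hlt' : x ⟨j, by omega⟩ < x ⟨j + 1, by omega⟩ := hx (by simp [Fin.lt_def])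
      have h1 := lexCol_spec (l := l) (K := k - 1) (Fin.lt_def.1 hlt') (x ⟨j + 1, by omega⟩).2
      have h2 : lexCol l (k - 1) (x ⟨j, by omega⟩) (x ⟨j + 1, by omega⟩) = i :=
        hc ⟨j, hj⟩ ⟨0, hl⟩
      rw [h2] at h1
      exact h1.2
    have hall : ∀ j (hj : j ≤ l),
        (x ⟨0, by omega⟩ : ℕ) / l ^ i + j ≤ (x ⟨j, by omega⟩ : ℕ) / l ^ i ∧
        (x ⟨0, by omega⟩ : ℕ) / l ^ (i + 1) = (x ⟨j, by omega⟩ : ℕ) / l ^ (i + 1) := by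
      intro j
      induction j with
      | zero => intro _; exact ⟨le_rfl, rfl⟩
      | succ j ih =>
        intro hj
        have h1 := ih (by omega)
        have h2 := hstep j (by omega)
        exact ⟨by omega, h1.2.trans h2.2⟩
    obtain ⟨h1, h2⟩ := hall l le_rfl
    rw [pow_succ, ← Nat.div_div_eq_div_mul, ← Nat.div_div_eq_div_mul] at h2
    have h3 := Nat.div_le_div_right (c := l) h1
    rw [Nat.add_div_right _ hl, ← h2] at h3
    omega
  · obtain ⟨y, hy, hinj⟩ := h
    have hlt' : ∀ i : Fin k, walkColours (fun u v : Fin (l ^ (k - 1)) =>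
        lexCol l (k - 1) u v) y i < k - 1 := by
      intro i
      exact (lexCol_spec (Fin.lt_def.1 (hy Fin.castSucc_lt_succ)) (y i.succ).2).1
    have := Fintype.card_le_of_injective (fun i : Fin k => (⟨_, hlt' i⟩ : Fin (k - 1)))
      (fun i j hij => hinj (by simpa using hij))
    simp at this
    omega

theorem f_eq {l k : ℕ} (hl : 0 < l) (hk : 0 < k) (h : 20 * (k - 1) ^ 3 ≤ l) :
    f l k = l ^ (k - 1) :=
  le_antisymm (Nat.sInf_le (upper_mem hl hk h))
    (le_csInf ⟨_, upper_mem hl hk h⟩ (fun b hb => lower_bd hl hk b hb))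

end FlashTop

/-- For every ε > 0 there is a constant C_ε > 0 such that for all positive integers
l and k with l ≥ C_ε · k³ · (log k)^{1+ε}, one has f(l, k) = l^{k-1}. -/
theorem f_eq_of_large (ε : ℝ) (hε : 0 < ε) :
    ∃ C : ℝ, 0 < C ∧ ∀ l k : ℕ, 0 < l → 0 < k →
      (l : ℝ) ≥ C * (k : ℝ) ^ 3 * Real.log k ^ ((1 : ℝ) + ε) →
      f l k = l ^ (k - 1) := by
  have hlog2 : 0 < Real.log 2 := Real.log_pos (by norm_num)
  have hpos : 0 < Real.log 2 ^ ((1 : ℝ) + ε) := Real.rpow_pos_of_pos hlog2 _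
  refine ⟨20 / Real.log 2 ^ ((1 : ℝ) + ε), by positivity, fun l k hl hk h => ?_⟩
  apply f_eq hl hk
  rcases Nat.lt_or_ge k 2 with hk2 | hk2
  · have : k = 1 := by omega
    subst this
    simp
  · have h1 : Real.log 2 ^ ((1 : ℝ) + ε) ≤ Real.log k ^ ((1 : ℝ) + ε) := by
      refine Real.rpow_le_rpow hlog2.le ?_ (by positivity)
      exact Real.log_le_log (by norm_num) (by exact_mod_cast hk2)
    have h2 : (20 : ℝ) * (k : ℝ) ^ 3 ≤ l := by
      refine le_trans ?_ h
      have h3 : (20 : ℝ) * (k : ℝ) ^ 3 = 20 / Real.log 2 ^ ((1 : ℝ) + ε) * (k : ℝ) ^ 3 *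
          Real.log 2 ^ ((1 : ℝ) + ε) := by
        field_simp
      rw [h3]
      exact mul_le_mul_of_nonneg_left h1 (by positivity)
    have h4 : 20 * k ^ 3 ≤ l := by exact_mod_cast h2
    refine le_trans ?_ h4
    gcongr
    omega
end

section
/- For all positive integers l and k, t(l, k) ≤ (1 + 2/√l)^k · l^{k-1}. -/
namespace TAsym

open Finset

variable {n : ℕ} {α : Type}

/-- A rainbow walk of length `k` inside the vertex set `S`. -/
def Rb (r : Fin n → Fin n → Prop) (c : Fin n → Fin n → α) (S : Finset (Fin n)) (k : ℕ)
    (y : Fin (k + 1) → Fin n) : Prop :=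
  (∀ i, y i ∈ S) ∧ IsWalk r y ∧ Function.Injective (walkColours c y)

lemma walkColours_cons {k : ℕ} (c : Fin n → Fin n → α) (v : Fin n) (y : Fin (k + 1) → Fin n) :
    walkColours c (Fin.cons v y : Fin (k + 1 + 1) → Fin n)
      = Fin.cons (c v (y 0)) (walkColours c y) := by
  funext i
  refine Fin.cases ?_ (fun j => ?_) i
  · simp only [walkColours, Fin.cons_zero, Fin.castSucc_zero, Fin.cons_succ]
  · simp only [walkColours, Fin.cons_succ, ← Fin.succ_castSucc]

lemma isWalk_cons {k : ℕ} (r : Fin n → Fin n → Prop) (v : Fin n) (y : Fin (k + 1) → Fin n)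
    (h : r v (y 0)) (hy : IsWalk r y) : IsWalk r (Fin.cons v y : Fin (k + 1 + 1) → Fin n) := by
  intro i
  refine Fin.cases ?_ (fun j => ?_) i
  · simpa using h
  · simpa only [Fin.cons_succ, ← Fin.succ_castSucc] using hy j

lemma walkColours_snoc {k : ℕ} (c : Fin n → Fin n → α) (v : Fin n) (y : Fin (k + 1) → Fin n) :
    walkColours c (Fin.snoc y v : Fin (k + 1 + 1) → Fin n)
      = Fin.snoc (walkColours c y) (c (y (Fin.last k)) v) := by
  funext i
  refine Fin.lastCases ?_ (fun j => ?_) i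
  · simp only [walkColours, Fin.snoc_last, Fin.snoc_castSucc, Fin.succ_last]
  · simp only [walkColours, Fin.snoc_castSucc, Fin.succ_castSucc]

lemma isWalk_snoc {k : ℕ} (r : Fin n → Fin n → Prop) (v : Fin n) (y : Fin (k + 1) → Fin n)
    (h : r (y (Fin.last k)) v) (hy : IsWalk r y) :
    IsWalk r (Fin.snoc y v : Fin (k + 1 + 1) → Fin n) := by
  intro i
  refine Fin.lastCases ?_ (fun j => ?_) i
  · simpa only [Fin.snoc_last, Fin.snoc_castSucc, Fin.succ_last] using h
  · simpa only [Fin.snoc_castSucc, Fin.succ_castSucc] using hy j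

lemma rb_cons {k : ℕ} {r : Fin n → Fin n → Prop} {c : Fin n → Fin n → α} {S : Finset (Fin n)}
    {v : Fin n} {y : Fin (k + 1) → Fin n} (hy : Rb r c S k y) (hv : v ∈ S) (h : r v (y 0))
    (hc : c v (y 0) ∉ Set.range (walkColours c y)) : Rb r c S (k + 1) (Fin.cons v y) := by
  refine ⟨fun i => ?_, isWalk_cons r v y h hy.2.1, ?_⟩
  · refine Fin.cases ?_ (fun j => ?_) i
    · simpa using hv
    · simpa using hy.1 j
  · rw [walkColours_cons]
    exact Fin.cons_injective_iff.2 ⟨hc, hy.2.2⟩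

lemma rb_snoc {k : ℕ} {r : Fin n → Fin n → Prop} {c : Fin n → Fin n → α} {S : Finset (Fin n)}
    {v : Fin n} {y : Fin (k + 1) → Fin n} (hy : Rb r c S k y) (hv : v ∈ S)
    (h : r (y (Fin.last k)) v)
    (hc : c (y (Fin.last k)) v ∉ Set.range (walkColours c y)) :
    Rb r c S (k + 1) (Fin.snoc y v) := by
  refine ⟨fun i => ?_, isWalk_snoc r v y h hy.2.1, ?_⟩
  · refine Fin.lastCases ?_ (fun j => ?_) i
    · simpa using hv
    · simpa using hy.1 j
  · rw [walkColours_snoc]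
    exact Fin.snoc_injective_iff.2 ⟨hy.2.2, hc⟩

/-- Without `l`-flashes each colour admits a bounded height function. -/
lemma exists_height {l : ℕ} (hl : 0 < l) {r : Fin n → Fin n → Prop} {c : Fin n → Fin n → α}
    (hf : ¬ HasFlash l r c) :
    ∃ h : α → Fin n → ℕ, (∀ a v, h a v ≤ l - 1) ∧ ∀ u v, r u v → h (c u v) u < h (c u v) v := by
  classical
  let P : α → Fin n → ℕ → Prop := fun a v j =>
    ∃ x : Fin (j + 1) → Fin n, IsWalk r x ∧ (∀ i, walkColours c x i = a) ∧ x (Fin.last j) = v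
  refine ⟨fun a v => Nat.findGreatest (P a v) (l - 1), fun a v => Nat.findGreatest_le _, ?_⟩
  intro u v huv
  have h0 : P (c u v) u 0 := ⟨fun _ => u, fun i => i.elim0, fun i => i.elim0, rfl⟩
  have h1 : P (c u v) u (Nat.findGreatest (P (c u v) u) (l - 1)) :=
    Nat.findGreatest_spec (Nat.zero_le _) h0
  have hle : Nat.findGreatest (P (c u v) u) (l - 1) ≤ l - 1 := Nat.findGreatest_le _
  show Nat.findGreatest (P (c u v) u) (l - 1) < Nat.findGreatest (P (c u v) v) (l - 1)
  generalize Nat.findGreatest (P (c u v) u) (l - 1) = j at h1 hle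
  have h2 : P (c u v) v (j + 1) := by
    obtain ⟨x, hx, hxc, hxl⟩ := h1
    refine ⟨Fin.snoc x v, isWalk_snoc r v x (by rw [hxl]; exact huv) hx, ?_, by simp⟩
    rw [walkColours_snoc]
    intro i
    refine Fin.lastCases ?_ (fun j => ?_) i
    · simp [hxl]
    · simp [hxc]
  by_cases hj : j + 1 ≤ l - 1
  · exact Nat.le_findGreatest hj h2
  · exfalso
    have : j + 1 = l := by omega
    subst this
    obtain ⟨x, hx, hxc, -⟩ := h2
    exact hf ⟨x, hx, fun i j => by rw [hxc, hxc]⟩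

/-- Weighted counting of pairwise disjoint boxes. -/
lemma boxes {ι V : Type} [Fintype ι] [DecidableEq ι] (T : Finset V) (l : ℕ) (w : ℕ → ℝ)
    (hw : ∀ i, 0 ≤ w i) (hsum : ∑ i ∈ range l, w i = 1) (F : V → ι → Finset ℕ)
    (hF : ∀ v ∈ T, ∀ a, F v a ⊆ range l)
    (hdisj : ∀ u ∈ T, ∀ v ∈ T, u ≠ v → ∃ a, Disjoint (F u a) (F v a)) :
    ∑ v ∈ T, ∏ a, ∑ i ∈ F v a, w i ≤ 1 := by
  classical
  have h1 : ∑ v ∈ T, ∏ a, ∑ i ∈ F v a, w i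
      = ∑ x ∈ T.biUnion (fun v => Fintype.piFinset (F v)), ∏ a, w (x a) := by
    rw [Finset.sum_biUnion]
    · exact Finset.sum_congr rfl fun v _ => Finset.prod_univ_sum _ _
    · intro u hu v hv huv
      obtain ⟨a, ha⟩ := hdisj u hu v hv huv
      refine Finset.disjoint_left.2 fun x hx hx' => ?_
      exact Finset.disjoint_left.1 ha (Fintype.mem_piFinset.1 hx a) (Fintype.mem_piFinset.1 hx' a)
  have h2 : ∑ x ∈ Fintype.piFinset (fun _ : ι => range l), ∏ a, w (x a) = 1 := by
    rw [← Finset.prod_univ_sum (fun _ : ι => range l) (fun _ i => w i)]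
    simp [hsum]
  rw [h1, ← h2]
  refine Finset.sum_le_sum_of_subset_of_nonneg ?_ fun x _ _ => Finset.prod_nonneg fun a _ => hw _
  intro x hx
  obtain ⟨v, hv, hx⟩ := Finset.mem_biUnion.1 hx
  rw [Fintype.mem_piFinset] at hx ⊢
  exact fun a => hF v hv a (hx a)

lemma sum_w (l : ℕ) (hl : 2 ≤ l) (q : ℝ) (hq : 2 * q + ((l : ℝ) - 2) * q ^ 2 = 1) :
    ∑ i ∈ range l, (if i = 0 ∨ i = l - 1 then q else q ^ 2) = 1 := by
  obtain ⟨m, rfl⟩ : ∃ m, l = m + 2 := ⟨l - 2, by omega⟩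
  rw [Finset.sum_range_succ, Finset.sum_range_succ']
  have : ∀ i ∈ range m, (if i + 1 = 0 ∨ i + 1 = m + 2 - 1 then q else q ^ 2) = q ^ 2 := by
    intro i hi
    rw [Finset.mem_range] at hi
    rw [if_neg]
    omega
  rw [Finset.sum_congr rfl this]
  simp
  push_cast at hq
  linarith

/-- Counting when few colours leave and enter each vertex. -/
lemma count [Fintype α] {l : ℕ} (hl : 2 ≤ l) {r : Fin n → Fin n → Prop} (hr : IsTournament r)
    {c : Fin n → Fin n → α} (hf : ¬ HasFlash l r c) (T : Finset (Fin n)) (m : ℕ)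
    (A B : Fin n → Finset α)
    (hA : ∀ v a, a ∈ A v ↔ ∃ u ∈ T, r v u ∧ c v u = a)
    (hB : ∀ v a, a ∈ B v ↔ ∃ u ∈ T, r u v ∧ c u v = a)
    (hAc : ∀ v ∈ T, #(A v) ≤ m) (hBc : ∀ v ∈ T, #(B v) ≤ m)
    (q : ℝ) (hq0 : 0 < q) (hq1 : q ≤ 1) (hq : 2 * q + ((l : ℝ) - 2) * q ^ 2 = 1) :
    (#T : ℝ) * (q ^ 2) ^ m ≤ 1 := by
  classical
  obtain ⟨h, hle, hlt⟩ := exists_height (by omega) hf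
  have hmid : ∀ v a, a ∈ A v → a ∈ B v → 0 < h a v ∧ h a v < l - 1 := by
    intro v a ha hb
    obtain ⟨u, -, hu, rfl⟩ := (hA v a).1 ha
    obtain ⟨u', -, hu', h'⟩ := (hB v _).1 hb
    have h1 := hlt _ _ hu
    have h2 := hlt _ _ hu'
    rw [h'] at h2
    have := hle (c v u) u
    omega
  let w : ℕ → ℝ := fun i => if i = 0 ∨ i = l - 1 then q else q ^ 2
  let p : Fin n → α → ℕ := fun v a =>
    if a ∈ B v then (if a ∈ A v then h a v else l - 1) else 0
  let F : Fin n → α → Finset ℕ := fun v a =>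
    if a ∈ A v ∨ a ∈ B v then {p v a} else range l
  have hsum : ∑ i ∈ range l, w i = 1 := sum_w l hl q hq
  have hbox := boxes T l w (fun i => by dsimp only [w]; split_ifs <;> positivity) hsum F
    (by
      intro v _ a i hi
      dsimp only [F] at hi
      split_ifs at hi
      · rw [Finset.mem_singleton] at hi
        rw [Finset.mem_range, hi]
        have := hle a v
        dsimp only [p]
        split_ifs <;> omega
      · exact hi)
    (by
      have key : ∀ u ∈ T, ∀ v ∈ T, r u v → Disjoint (F u (c u v)) (F v (c u v)) := by
        intro u hu v hv huv
        have ha : c u v ∈ A u := (hA _ _).2 ⟨v, hv, huv, rfl⟩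
        have hb : c u v ∈ B v := (hB _ _).2 ⟨u, hu, huv, rfl⟩
        have h1 := hlt u v huv
        have h2 := hmid u (c u v) ha
        have h3 := fun ha' => hmid v (c u v) ha' hb
        simp only [F, ha, hb, or_true, true_or, if_true, Finset.disjoint_singleton, p]
        split_ifs with h4 h5 h5
        · omega
        · have := h2 h4
          omega
        · have := h3 h5
          omega
        · omega
      intro u hu v hv huv
      by_cases h1 : r u v
      · exact ⟨_, key u hu v hv h1⟩
      · have h2 : r v u := by
          by_contra h2
          exact h1 ((hr.2 u v huv).2 h2)
        exact ⟨_, (key v hv u hu h2).symm⟩)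
  have hterm : ∀ v ∈ T, (q ^ 2) ^ m ≤ ∏ a, ∑ i ∈ F v a, w i := by
    intro v hv
    have h1 : ∀ a, ∑ i ∈ F v a, w i = (if a ∈ A v then q else 1) * (if a ∈ B v then q else 1) := by
      intro a
      by_cases ha : a ∈ A v <;> by_cases hb : a ∈ B v
      · have := hmid v a ha hb
        have h2 : ¬ (h a v = 0 ∨ h a v = l - 1) := by omega
        simp only [F, p, w, ha, hb, if_true, true_or, Finset.sum_singleton, h2, if_false]
        ring
      · simp [F, p, w, ha, hb]
      · simp [F, p, w, ha, hb]
      · simp only [F, ha, hb, or_self, if_false, hsum]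
        norm_num
    rw [Finset.prod_congr rfl fun a _ => h1 a, Finset.prod_mul_distrib, Finset.prod_ite_mem,
      Finset.prod_ite_mem, Finset.univ_inter, Finset.univ_inter, Finset.prod_const,
      Finset.prod_const, ← pow_add, ← pow_mul]
    have := hAc v hv
    have := hBc v hv
    exact pow_le_pow_of_le_one hq0.le hq1 (by omega)
  calc (#T : ℝ) * (q ^ 2) ^ m = ∑ v ∈ T, (q ^ 2) ^ m := by simp
    _ ≤ _ := Finset.sum_le_sum hterm
    _ ≤ 1 := hbox

lemma exists_q (l : ℕ) (hl : 2 ≤ l) : ∃ q : ℝ, 0 < q ∧ q ≤ 1 ∧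
    2 * q + ((l : ℝ) - 2) * q ^ 2 = 1 ∧ (q ^ 2)⁻¹ ≤ (1 + 2 / √(l : ℝ)) * l := by
  have hl' : (2 : ℝ) ≤ l := by exact_mod_cast hl
  set s := √((l : ℝ) - 1) with hs
  have hs2 : s ^ 2 = l - 1 := Real.sq_sqrt (by linarith)
  have hs0 : 0 ≤ s := Real.sqrt_nonneg _
  have ht2 : √(l : ℝ) ^ 2 = l := Real.sq_sqrt (by linarith)
  have ht0 : 0 < √(l : ℝ) := Real.sqrt_pos.2 (by linarith)
  have hst : s ≤ √(l : ℝ) := Real.sqrt_le_sqrt (by linarith)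
  refine ⟨(1 + s)⁻¹, by positivity, inv_le_one_of_one_le₀ (by linarith), ?_, ?_⟩
  · field_simp
    nlinarith
  · have : (1 + 2 / √(l : ℝ)) * l = l + 2 * √(l : ℝ) := by
      field_simp
      nlinarith
    rw [this, inv_pow, inv_inv]
    nlinarith

lemma main_bound [Fintype α] {l : ℕ} (hl : 2 ≤ l) {r : Fin n → Fin n → Prop}
    (hr : IsTournament r) {c : Fin n → Fin n → α} (hf : ¬ HasFlash l r c) (m : ℕ) :
    ∀ S : Finset (Fin n), (¬ ∃ y, Rb r c S (m + 1) y) →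
      (#S : ℝ) ≤ (1 + 2 / √(l : ℝ)) * ((1 + 2 / √(l : ℝ)) * l) ^ m := by
  classical
  have hl' : (2 : ℝ) ≤ l := by exact_mod_cast hl
  have ht2 : √(l : ℝ) ^ 2 = l := Real.sq_sqrt (by linarith)
  have ht0 : 0 < √(l : ℝ) := Real.sqrt_pos.2 (by linarith)
  induction m with
  | zero =>
    intro S hS
    have h1 : #S ≤ 1 := by
      rw [Finset.card_le_one]
      have key : ∀ u ∈ S, ∀ v ∈ S, ¬ r u v := by
        intro u hu v hv huv
        refine hS ⟨Fin.cons u (fun _ => v), rb_cons ⟨fun _ => hv, fun i => i.elim0,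
          fun i => i.elim0⟩ hu huv ?_⟩
        rintro ⟨i, -⟩
        exact i.elim0
      intro u hu v hv
      by_contra huv
      exact key u hu v hv ((hr.2 u v huv).2 (key v hv u hu))
    have h2 : (#S : ℝ) ≤ 1 := by exact_mod_cast h1
    have h3 : 0 ≤ 2 / √(l : ℝ) := by positivity
    simp only [pow_zero, mul_one]
    linarith
  | succ m ih =>
    intro S hS
    let S₁ := S.filter fun v => ¬ ∃ y, Rb r c S (m + 1) y ∧ y (Fin.last _) = v
    let S₂ := S.filter fun v => ¬ ∃ y, Rb r c S (m + 1) y ∧ y 0 = v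
    let T := S.filter fun v => (∃ y, Rb r c S (m + 1) y ∧ y (Fin.last _) = v) ∧
      ∃ y, Rb r c S (m + 1) y ∧ y 0 = v
    have hS₁ := ih S₁ (by
      rintro ⟨y, hy⟩
      exact (Finset.mem_filter.1 (hy.1 (Fin.last _))).2
        ⟨y, ⟨fun i => (Finset.mem_filter.1 (hy.1 i)).1, hy.2⟩, rfl⟩)
    have hS₂ := ih S₂ (by
      rintro ⟨y, hy⟩
      exact (Finset.mem_filter.1 (hy.1 0)).2
        ⟨y, ⟨fun i => (Finset.mem_filter.1 (hy.1 i)).1, hy.2⟩, rfl⟩)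
    obtain ⟨q, hq0, hq1, hq, hqi⟩ := exists_q l hl
    have hT := count hl hr hf T (m + 1)
      (fun v => Finset.univ.filter fun a => ∃ u ∈ T, r v u ∧ c v u = a)
      (fun v => Finset.univ.filter fun a => ∃ u ∈ T, r u v ∧ c u v = a)
      (by simp) (by simp)
      (by
        intro v hv
        obtain ⟨y, hy, rfl⟩ := (Finset.mem_filter.1 hv).2.1
        calc _ ≤ #(Finset.univ.image (walkColours c y)) := Finset.card_le_card ?_
          _ ≤ _ := Finset.card_image_le
          _ = m + 1 := by simp
        intro a ha
        obtain ⟨u, hu, hvu, rfl⟩ := (Finset.mem_filter.1 ha).2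
        by_contra hn
        refine hS ⟨_, rb_snoc hy (Finset.mem_filter.1 hu).1 hvu ?_⟩
        simpa using hn)
      (by
        intro v hv
        obtain ⟨y, hy, rfl⟩ := (Finset.mem_filter.1 hv).2.2
        calc _ ≤ #(Finset.univ.image (walkColours c y)) := Finset.card_le_card ?_
          _ ≤ _ := Finset.card_image_le
          _ = m + 1 := by simp
        intro a ha
        obtain ⟨u, hu, hvu, rfl⟩ := (Finset.mem_filter.1 ha).2
        by_contra hn
        refine hS ⟨_, rb_cons hy (Finset.mem_filter.1 hu).1 hvu ?_⟩
        simpa using hn)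
      q hq0 hq1 hq
    have hcard : #S ≤ #S₁ + #S₂ + #T := by
      have : S ⊆ S₁ ∪ S₂ ∪ T := by
        intro v hv
        simp only [S₁, S₂, T, Finset.mem_union, Finset.mem_filter]
        tauto
      calc #S ≤ _ := Finset.card_le_card this
        _ ≤ #(S₁ ∪ S₂) + #T := Finset.card_union_le _ _
        _ ≤ _ := Nat.add_le_add_right (Finset.card_union_le _ _) _
    have hcard' : (#S : ℝ) ≤ #S₁ + #S₂ + #T := by exact_mod_cast hcard
    set D : ℝ := (1 + 2 / √(l : ℝ)) * l with hD
    have hT' : (#T : ℝ) ≤ D ^ (m + 1) := by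
      have h1 : (#T : ℝ) ≤ ((q ^ 2) ^ (m + 1))⁻¹ := by
        rw [← one_div, le_div_iff₀ (by positivity)]
        exact hT
      refine h1.trans ?_
      rw [← inv_pow]
      exact pow_le_pow_left₀ (by positivity) hqi _
    have hDp : 0 ≤ D ^ m := by positivity
    have h1t : 1 ≤ √(l : ℝ) := by nlinarith
    have hkey : 2 * (1 + 2 / √(l : ℝ)) ≤ 2 / √(l : ℝ) * D := by
      have : 2 / √(l : ℝ) * D = 2 * √(l : ℝ) * (1 + 2 / √(l : ℝ)) := by
        rw [hD]
        nth_rewrite 3 [← ht2]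
        field_simp
      rw [this]
      have : 0 ≤ 1 + 2 / √(l : ℝ) := by positivity
      nlinarith
    have := mul_le_mul_of_nonneg_right hkey hDp
    rw [pow_succ] at hT' ⊢
    nlinarith

end TAsym

/-- For all positive integers l and k, t(l, k) ≤ (1 + 2/√l)^k · l^{k-1}. -/
theorem t_asymptotic (l k : ℕ) (hl : 0 < l) (hk : 0 < k) :
    (t l k : ℝ) ≤ (1 + 2 / Real.sqrt l) ^ k * (l : ℝ) ^ (k - 1) := by
  obtain ⟨m, rfl⟩ : ∃ m, k = m + 1 := ⟨k - 1, by omega⟩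
  have hl' : (1 : ℝ) ≤ l := by exact_mod_cast hl
  have hb : (1 + 2 / Real.sqrt l) ^ (m + 1) * (l : ℝ) ^ (m + 1 - 1)
      = (1 + 2 / √(l : ℝ)) * ((1 + 2 / √(l : ℝ)) * l) ^ m := by
    rw [Nat.add_sub_cancel, mul_pow, pow_succ]
    ring
  rw [hb]
  have hnn : 0 ≤ (1 + 2 / √(l : ℝ)) * ((1 + 2 / √(l : ℝ)) * l) ^ m := by positivity
  refine le_trans ?_ (Nat.floor_le hnn)
  rw [Nat.cast_le]
  refine Nat.sInf_le ?_
  intro n hn r hr α c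
  rw [gt_iff_lt, Nat.floor_lt hnn] at hn
  by_contra hcon
  rw [not_or] at hcon
  obtain ⟨hf, hR⟩ := hcon
  rcases Nat.lt_or_ge l 2 with h2 | h2
  · have : l = 1 := by omega
    subst this
    have h3 : (1 : ℝ) < n := by
      refine lt_of_le_of_lt ?_ hn
      have h4 : (1 : ℝ) ≤ 1 + 2 / √((1 : ℕ) : ℝ) := by norm_num
      have h5 : (1 : ℝ) ≤ (1 + 2 / √((1 : ℕ) : ℝ)) * ((1 : ℕ) : ℝ) := by norm_num
      have := one_le_pow₀ h5 (n := m)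
      nlinarith
    have h4 : 1 < n := by exact_mod_cast h3
    have key : ∀ u v : Fin n, ¬ r u v := by
      intro u v huv
      refine hf ⟨Fin.cons u (fun _ => v), TAsym.isWalk_cons r u _ huv fun i => i.elim0, ?_⟩
      intro i j
      rw [Subsingleton.elim i j]
    have hne : (⟨0, by omega⟩ : Fin n) ≠ ⟨1, h4⟩ := by simp
    exact key _ _ ((hr.2 _ _ hne).2 (key _ _))
  · classical
    let c' : Fin n → Fin n → Set.range (fun p : Fin n × Fin n => c p.1 p.2) :=
      fun u v => ⟨c u v, ⟨(u, v), rfl⟩⟩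
    haveI : Fintype (Set.range (fun p : Fin n × Fin n => c p.1 p.2)) := Fintype.ofFinite _
    have hf' : ¬ HasFlash l r c' := by
      rintro ⟨x, hx, hc⟩
      exact hf ⟨x, hx, fun i j => congrArg Subtype.val (hc i j)⟩
    have := TAsym.main_bound h2 hr hf' m Finset.univ (by
      rintro ⟨y, -, hy, hc⟩
      exact hR ⟨y, hy, fun i j hij => hc (Subtype.ext hij)⟩)
    rw [Finset.card_univ, Fintype.card_fin] at this
    linarith
end

section
/- For all integers l ≥ 2 and k ≥ 3, there exists a tournament with exactly f(l,k) − 1 vertices such that every edge colouring of this tournament contains an l-flash or a k-rainbow. -/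
/-! ### Finiteness of `f` -/

/-- Flash inside a set of vertices. -/
def FlashIn {n : ℕ} {α : Type} (l : ℕ) (c : Fin n → Fin n → α) (S : Finset (Fin n)) : Prop :=
  ∃ x : Fin (l + 1) → Fin n, StrictMono x ∧ (∀ i, x i ∈ S) ∧
    ∀ i j : Fin l, walkColours c x i = walkColours c x j

/-- Rainbow inside a set of vertices. -/
def RainbowIn {n : ℕ} {α : Type} (k : ℕ) (c : Fin n → Fin n → α) (S : Finset (Fin n)) : Prop :=
  ∃ x : Fin (k + 1) → Fin n, StrictMono x ∧ (∀ i, x i ∈ S) ∧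
    Function.Injective (walkColours c x)

open Classical in
lemma exists_seq (k s : ℕ) : ∃ B : ℕ, ∀ (n : ℕ) (α : Type) (c : Fin n → Fin n → α)
    (S : Finset (Fin n)), B < S.card →
    (∀ v ∈ S, ∃ C : Finset α, C.card ≤ k ∧ ∀ u ∈ S, v < u → c v u ∈ C) →
    ∃ (x : ℕ → Fin n) (g : ℕ → α), (∀ i ≤ s, x i ∈ S) ∧
      ∀ i j, i < j → j ≤ s → x i < x j ∧ c (x i) (x j) = g i := by
  induction s with
  | zero =>
    refine ⟨0, fun n α c S hS _ => ?_⟩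
    obtain ⟨v, hv⟩ := Finset.card_pos.1 hS
    exact ⟨fun _ => v, fun _ => c v v, fun _ _ => hv, fun i j h1 h2 => by omega⟩
  | succ s ih =>
    obtain ⟨B, hB⟩ := ih
    refine ⟨k * B + 1, fun n α c S hS hC => ?_⟩
    have hne : S.Nonempty := Finset.card_pos.1 (by omega)
    set v := S.min' hne with hv
    have hvS : v ∈ S := S.min'_mem hne
    obtain ⟨C, hCk, hCm⟩ := hC v hvS
    have hlt : ∀ u ∈ S.erase v, v < u := fun u hu =>
      lt_of_le_of_ne (S.min'_le u (Finset.mem_of_mem_erase hu)) (Finset.ne_of_mem_erase hu).symm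
    have hmap : ∀ u ∈ S.erase v, c v u ∈ C := fun u hu =>
      hCm u (Finset.mem_of_mem_erase hu) (hlt u hu)
    have hcard : C.card * B < (S.erase v).card := by
      rw [Finset.card_erase_of_mem hvS]
      have := Nat.mul_le_mul_right B hCk
      omega
    obtain ⟨a, ha, hfib⟩ := Finset.exists_lt_card_fiber_of_mul_lt_card_of_maps_to hmap hcard
    obtain ⟨x, g, hx, hg⟩ := hB n α c _ hfib (by
      intro w hw
      simp only [Finset.mem_filter, Finset.mem_erase] at hw
      obtain ⟨C', h1, h2⟩ := hC w hw.1.2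
      refine ⟨C', h1, fun u hu => h2 u ?_⟩
      simp only [Finset.mem_filter, Finset.mem_erase] at hu
      exact hu.1.2)
    have hx' : ∀ i ≤ s, x i ∈ S.erase v ∧ c v (x i) = a := fun i hi =>
      Finset.mem_filter.1 (hx i hi)
    refine ⟨fun i => Nat.casesOn i v x, fun i => Nat.casesOn i a g, ?_, ?_⟩
    · intro i hi
      cases i with
      | zero => exact hvS
      | succ i => exact Finset.mem_of_mem_erase (hx' i (by omega)).1
    · intro i j hij hj
      cases j with
      | zero => omega
      | succ j =>
        cases i with
        | zero => exact ⟨hlt _ (hx' j (by omega)).1, (hx' j (by omega)).2⟩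
        | succ i => exact hg i j (by omega) (by omega)

lemma extract {n : ℕ} {α : Type} (c : Fin n → Fin n → α) (S : Finset (Fin n)) (s m : ℕ)
    (x : ℕ → Fin n) (g : ℕ → α) (hx : ∀ i ≤ s, x i ∈ S)
    (hg : ∀ i j, i < j → j ≤ s → x i < x j ∧ c (x i) (x j) = g i)
    (t : Finset ℕ) (ht : t ⊆ Finset.range s) (hm : t.card = m) :
    ∃ (y : Fin (m + 1) → Fin n) (e : Fin m → ℕ), StrictMono y ∧ (∀ i, y i ∈ S) ∧
      Function.Injective e ∧ (∀ i, e i ∈ t) ∧ ∀ i, walkColours c y i = g (e i) := by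
  have hs : s ∉ t := fun h => by simpa using ht h
  have hcard : (insert s t).card = m + 1 := by rw [Finset.card_insert_of_notMem hs, hm]
  have hle : ∀ i, (insert s t).orderEmbOfFin hcard i ≤ s := by
    intro i
    have := Finset.orderEmbOfFin_mem (insert s t) hcard i
    rcases Finset.mem_insert.1 this with h | h
    · omega
    · have := Finset.mem_range.1 (ht h)
      omega
  set E := (insert s t).orderEmbOfFin hcard with hE
  have hlt : ∀ i j, i < j → E i < E j := fun i j h => E.strictMono h
  refine ⟨fun i => x (E i), fun i => E i.castSucc, ?_, ?_, ?_, ?_, ?_⟩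
  · intro i j hij
    exact (hg _ _ (hlt i j hij) (hle j)).1
  · exact fun i => hx _ (hle i)
  · intro i j h
    exact Fin.castSucc_injective _ (E.injective h)
  · intro i
    have h1 := hlt i.castSucc i.succ Fin.castSucc_lt_succ
    have h2 := hle i.succ
    rcases Finset.mem_insert.1 (Finset.orderEmbOfFin_mem (insert s t) hcard i.castSucc) with h | h
    · have : E i.castSucc = s := h
      omega
    · exact h
  · intro i
    exact (hg _ _ (hlt i.castSucc i.succ Fin.castSucc_lt_succ) (hle i.succ)).2

open Classical in
lemma ramsey (l k : ℕ) : ∃ m : ℕ, ∀ (n : ℕ) (α : Type) (c : Fin n → Fin n → α)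
    (S : Finset (Fin n)), m < S.card → FlashIn l c S ∨ RainbowIn k c S := by
  induction k with
  | zero =>
    refine ⟨0, fun n α c S hS => Or.inr ?_⟩
    obtain ⟨v, hv⟩ := Finset.card_pos.1 hS
    refine ⟨fun _ => v, fun i j h => ?_, fun _ => hv, fun i => i.elim0⟩
    omega
  | succ k ih =>
    obtain ⟨m, hm⟩ := ih
    obtain ⟨B, hB⟩ := exists_seq k (k * l + 1)
    refine ⟨m + B, fun n α c S hS => ?_⟩
    by_contra hcon
    push Not at hcon
    obtain ⟨hF, hR⟩ := hcon
    set D := S.filter (fun v => ∃ y : Fin (k + 1) → Fin n, StrictMono y ∧ (∀ i, y i ∈ S) ∧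
      Function.Injective (walkColours c y) ∧ y (Fin.last k) = v) with hD
    have h1 : (S \ D).card ≤ m := by
      by_contra h
      rcases hm n α c (S \ D) (by omega) with ⟨x, h1, h2, h3⟩ | ⟨y, h1, h2, h3⟩
      · exact hF ⟨x, h1, fun i => (Finset.mem_sdiff.1 (h2 i)).1, h3⟩
      · have := Finset.mem_sdiff.1 (h2 (Fin.last k))
        exact this.2 (Finset.mem_filter.2
          ⟨this.1, y, h1, fun i => (Finset.mem_sdiff.1 (h2 i)).1, h3, rfl⟩)
    have h2 : (S \ D).card + D.card = S.card :=
      Finset.card_sdiff_add_card_eq_card (Finset.filter_subset _ _)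
    have hDS : D ⊆ S := Finset.filter_subset _ _
    obtain ⟨x, g, hx, hg⟩ := hB n α c D (by omega) (by
      intro v hv
      obtain ⟨hvS, y, hy1, hy2, hy3, hy4⟩ := Finset.mem_filter.1 hv
      refine ⟨Finset.univ.image (walkColours c y), ?_, ?_⟩
      · exact Finset.card_image_le.trans (by simp)
      · intro u hu hvu
        by_contra hnot
        apply hR
        have hcol : walkColours c (Fin.snoc (α := fun _ => Fin n) y u) =
            Fin.snoc (α := fun _ => α) (walkColours c y) (c v u) := by
          funext i
          refine Fin.lastCases ?_ (fun i => ?_) i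
          · simp [walkColours, hy4]
          · simp only [walkColours, Fin.snoc_castSucc, ← Fin.castSucc_succ]
        refine ⟨Fin.snoc (α := fun _ => Fin n) y u, ?_, ?_, ?_⟩
        · rw [Fin.strictMono_iff_lt_succ]
          intro i
          refine Fin.lastCases ?_ (fun i => ?_) i
          · simpa [hy4] using hvu
          · rw [← Fin.castSucc_succ, Fin.snoc_castSucc, Fin.snoc_castSucc]
            exact hy1 Fin.castSucc_lt_succ
        · intro i
          refine Fin.lastCases ?_ (fun i => ?_) i
          · simpa using hDS hu
          · simpa using hy2 i
        · rw [hcol, Fin.snoc_injective_iff]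
          refine ⟨hy3, fun hmem => hnot ?_⟩
          obtain ⟨i, hi⟩ := hmem
          exact Finset.mem_image.2 ⟨i, Finset.mem_univ _, hi⟩)
    by_cases hcard : k + 1 ≤ ((Finset.range (k * l + 1)).image g).card
    · obtain ⟨t, ht, htc, hinj⟩ : ∃ t ⊆ Finset.range (k * l + 1), t.card = k + 1 ∧
          Set.InjOn g t := by
        obtain ⟨I, hI, hIc⟩ := Finset.exists_subset_card_eq hcard
        obtain ⟨t, ht, hinj, him⟩ := Finset.exists_subset_injOn_image_eq_of_surjOn
          (f := g) (s := Finset.range (k * l + 1)) (t := I) (by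
            intro a ha
            obtain ⟨i, hi, rfl⟩ := Finset.mem_image.1 (hI ha)
            exact ⟨i, hi, rfl⟩)
        refine ⟨t, ht, ?_, hinj⟩
        rw [← hIc, ← him, Finset.card_image_of_injOn hinj]
      obtain ⟨y, e, h1, h2, h3, h4, h5⟩ := extract c D _ (k + 1) x g hx hg t ht htc
      refine hR ⟨y, h1, fun i => hDS (h2 i), fun i j hij => ?_⟩
      rw [h5, h5] at hij
      exact h3 (hinj (h4 i) (h4 j) hij)
    · obtain ⟨a, ha, hfib⟩ := Finset.exists_lt_card_fiber_of_mul_lt_card_of_maps_to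
        (s := Finset.range (k * l + 1)) (t := (Finset.range (k * l + 1)).image g) (f := g)
        (n := l) (fun i hi => Finset.mem_image_of_mem _ hi) (by
          rw [Finset.card_range]
          have := Nat.mul_le_mul_right l (show _ ≤ k by omega : 
            ((Finset.range (k * l + 1)).image g).card ≤ k)
          omega)
      obtain ⟨t, ht, htc⟩ := Finset.exists_subset_card_eq hfib.le
      obtain ⟨y, e, h1, h2, h3, h4, h5⟩ := extract c D _ l x g hx hg t
        (ht.trans (Finset.filter_subset _ _)) htc
      refine hF ⟨y, h1, fun i => hDS (h2 i), fun i j => ?_⟩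
      rw [h5, h5, (Finset.mem_filter.1 (ht (h4 i))).2, (Finset.mem_filter.1 (ht (h4 j))).2]

lemma f_mem (l k : ℕ) : f l k ∈ fSet l k := by
  apply Nat.sInf_mem
  obtain ⟨m, hm⟩ := ramsey l k
  refine ⟨m, fun n hn α c => ?_⟩
  rcases hm n α c Finset.univ (by simpa using hn) with ⟨x, h1, _, h3⟩ | ⟨x, h1, _, h3⟩
  · exact Or.inl ⟨x, h1, h3⟩
  · exact Or.inr ⟨x, h1, h3⟩

/-! ### The tournament -/

/-- Transitive tournament with the edge between the first and last vertex reversed. -/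
def revT (N : ℕ) (u v : Fin N) : Prop :=
  (u.val < v.val ∧ ¬ (u.val = 0 ∧ v.val + 1 = N)) ∨ (u.val + 1 = N ∧ v.val = 0)

lemma revT_tournament (N : ℕ) (hN : 2 ≤ N) : IsTournament (revT N) := by
  refine ⟨fun v => ?_, fun u v huv => ?_⟩
  · unfold revT
    omega
  · have : u.val ≠ v.val := fun h => huv (Fin.ext h)
    unfold revT
    omega

/-- The unrolled colouring on `N + 2` vertices, in the order last, first, middle, last, first. -/
def unroll {α : Type} (N : ℕ) (hN : 2 ≤ N) (c : Fin N → Fin N → α) (a b : Fin (N + 2)) :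
    Option α :=
  if a.val ≤ 1 then
    if b.val ≤ 1 then some (c ⟨N - 1, by omega⟩ ⟨0, by omega⟩)
    else if h : b.val < N then some (c ⟨0, by omega⟩ ⟨b.val - 1, by omega⟩)
    else none
  else if h : a.val < N then
    if h' : b.val < N then some (c ⟨a.val - 1, by omega⟩ ⟨b.val - 1, by omega⟩)
    else some (c ⟨a.val - 1, by omega⟩ ⟨N - 1, by omega⟩)
  else some (c ⟨N - 1, by omega⟩ ⟨0, by omega⟩)

open Classical in
lemma lift_walk {α : Type} (N m : ℕ) (hN : 2 ≤ N) (c : Fin N → Fin N → α)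
    (y : Fin (m + 1) → Fin (N + 2)) (hy : StrictMono y) (i₀ : Fin (m + 1))
    (h1 : 2 ≤ (y i₀).val) (h2 : (y i₀).val < N) :
    ∃ z : Fin (m + 1) → Fin N, IsWalk (revT N) z ∧
      ∀ i, walkColours (unroll N hN c) y i = some (walkColours c z i) := by
  let z : Fin (m + 1) → Fin N := fun j =>
    if (y j).val ≤ 1 then
      if ∃ j', j < j' ∧ (y j').val = 1 then ⟨N - 1, by omega⟩ else ⟨0, by omega⟩
    else if h : (y j).val < N then ⟨(y j).val - 1, by omega⟩
    else if ∃ j', j' < j ∧ (y j').val = N then ⟨0, by omega⟩ else ⟨N - 1, by omega⟩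
  have key : ∀ i : Fin m, revT N (z i.castSucc) (z i.succ) ∧
      unroll N hN c (y i.castSucc) (y i.succ) = some (c (z i.castSucc) (z i.succ)) := by
    intro i
    have hmono : ∀ p q : Fin (m + 1), p ≤ q → (y p).val ≤ (y q).val := fun p q h =>
      hy.monotone h
    have hab : (y i.castSucc).val < (y i.succ).val := hy Fin.castSucc_lt_succ
    have hb : (y i.succ).val < N + 2 := (y i.succ).isLt
    have hsucc : ∀ j : Fin (m + 1), i.castSucc < j → i.succ ≤ j := fun j h =>
      Fin.castSucc_lt_iff_succ_le.1 h
    have hpred : ∀ j : Fin (m + 1), j < i.succ → j ≤ i.castSucc := fun j h =>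
      Fin.le_castSucc_iff.2 h
    by_cases ha1 : (y i.castSucc).val ≤ 1
    · by_cases hb1 : (y i.succ).val ≤ 1
      · have e1 : z i.castSucc = ⟨N - 1, by omega⟩ := by
          have : ∃ j', i.castSucc < j' ∧ (y j').val = 1 :=
            ⟨i.succ, Fin.castSucc_lt_succ, by omega⟩
          simp only [z, if_pos ha1, if_pos this]
        have e2 : z i.succ = ⟨0, by omega⟩ := by
          have : ¬ ∃ j', i.succ < j' ∧ (y j').val = 1 := by
            rintro ⟨j', hj, hj'⟩
            have : (y i.succ).val < (y j').val := hy hj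
            omega
          simp only [z, if_pos hb1, if_neg this]
        rw [e1, e2]
        refine ⟨?_, by simp only [unroll, if_pos ha1, if_pos hb1]⟩
        exact Or.inr ⟨show N - 1 + 1 = N by omega, rfl⟩
      · by_cases hbN : (y i.succ).val < N
        · have e1 : z i.castSucc = ⟨0, by omega⟩ := by
            have : ¬ ∃ j', i.castSucc < j' ∧ (y j').val = 1 := by
              rintro ⟨j', hj, hj'⟩
              have := hmono _ _ (hsucc j' hj)
              omega
            simp only [z, if_pos ha1, if_neg this]
          have e2 : z i.succ = ⟨(y i.succ).val - 1, by omega⟩ := by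
            simp only [z, if_neg hb1, dif_pos hbN]
          rw [e1, e2]
          refine ⟨?_, by simp only [unroll, if_pos ha1, if_neg hb1, dif_pos hbN]⟩
          simp only [revT]
          omega
        · exfalso
          rcases le_or_gt i₀ i.castSucc with h | h
          · have := hmono _ _ h
            omega
          · have := hmono _ _ (hsucc _ h)
            omega
    · have hb1 : ¬ (y i.succ).val ≤ 1 := by omega
      by_cases haN : (y i.castSucc).val < N
      · have e1 : z i.castSucc = ⟨(y i.castSucc).val - 1, by omega⟩ := by
          simp only [z, if_neg ha1, dif_pos haN]
        by_cases hbN : (y i.succ).val < N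
        · have e2 : z i.succ = ⟨(y i.succ).val - 1, by omega⟩ := by
            simp only [z, if_neg hb1, dif_pos hbN]
          rw [e1, e2]
          refine ⟨?_, by simp only [unroll, if_neg ha1, dif_pos haN, dif_pos hbN]⟩
          simp only [revT]
          omega
        · have e2 : z i.succ = ⟨N - 1, by omega⟩ := by
            have : ¬ ∃ j', j' < i.succ ∧ (y j').val = N := by
              rintro ⟨j', hj, hj'⟩
              have := hmono _ _ (hpred j' hj)
              omega
            simp only [z, if_neg hb1, dif_neg hbN, if_neg this]
          rw [e1, e2]
          refine ⟨?_, by simp only [unroll, if_neg ha1, dif_pos haN, dif_neg hbN]⟩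
          simp only [revT]
          omega
      · have hbN : ¬ (y i.succ).val < N := by omega
        have e1 : z i.castSucc = ⟨N - 1, by omega⟩ := by
          have : ¬ ∃ j', j' < i.castSucc ∧ (y j').val = N := by
            rintro ⟨j', hj, hj'⟩
            have : (y j').val < (y i.castSucc).val := hy hj
            omega
          simp only [z, if_neg ha1, dif_neg haN, if_neg this]
        have e2 : z i.succ = ⟨0, by omega⟩ := by
          have : ∃ j', j' < i.succ ∧ (y j').val = N :=
            ⟨i.castSucc, Fin.castSucc_lt_succ, by omega⟩
          simp only [z, if_neg hb1, dif_neg hbN, if_pos this]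
        rw [e1, e2]
        refine ⟨?_, by simp only [unroll, if_neg ha1, dif_neg haN]⟩
        exact Or.inr ⟨show N - 1 + 1 = N by omega, rfl⟩
  exact ⟨z, fun i => (key i).1, fun i => (key i).2⟩

lemma unroll_good {α : Type} (N l k : ℕ) (hl : 2 ≤ l) (hk : 3 ≤ k) (hN : 2 ≤ N)
    (c : Fin N → Fin N → α)
    (h : HasMonoFlash l (unroll N hN c) ∨ HasMonoRainbow k (unroll N hN c)) :
    HasFlash l (revT N) c ∨ HasRainbow k (revT N) c := by
  rcases h with ⟨y, hy, hc⟩ | ⟨y, hy, hc⟩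
  · left
    by_cases hM : ∃ i₀, 2 ≤ (y i₀).val ∧ (y i₀).val < N
    · obtain ⟨i₀, h1, h2⟩ := hM
      obtain ⟨z, hz, hzc⟩ := lift_walk N l hN c y hy i₀ h1 h2
      refine ⟨z, hz, fun i j => ?_⟩
      have := hc i j
      rw [hzc, hzc] at this
      exact Option.some_injective _ this
    · exfalso
      push Not at hM
      have := hc ⟨0, by omega⟩ ⟨1, by omega⟩
      simp only [walkColours] at this
      have l1 : (y (Fin.castSucc ⟨0, by omega⟩)).val < (y (Fin.succ ⟨0, by omega⟩)).val :=
        hy Fin.castSucc_lt_succ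
      have l2 : (y (Fin.castSucc ⟨1, by omega⟩)).val < (y (Fin.succ ⟨1, by omega⟩)).val :=
        hy Fin.castSucc_lt_succ
      have e : (Fin.castSucc ⟨1, by omega⟩ : Fin (l + 1)) = Fin.succ ⟨0, by omega⟩ := rfl
      rw [e] at this l2
      have m0 := hM (Fin.castSucc ⟨0, by omega⟩)
      have m1 := hM (Fin.succ ⟨0, by omega⟩)
      have m2 := hM (Fin.succ ⟨1, by omega⟩)
      generalize y (Fin.castSucc ⟨0, by omega⟩) = a at *
      generalize y (Fin.succ ⟨0, by omega⟩) = b at *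
      generalize y (Fin.succ ⟨1, by omega⟩) = d at *
      have hd := d.isLt
      unfold unroll at this
      split_ifs at this <;> omega
  · right
    by_cases hM : ∃ i₀, 2 ≤ (y i₀).val ∧ (y i₀).val < N
    · obtain ⟨i₀, h1, h2⟩ := hM
      obtain ⟨z, hz, hzc⟩ := lift_walk N k hN c y hy i₀ h1 h2
      refine ⟨z, hz, fun i j hij => hc ?_⟩
      rw [hzc, hzc, hij]
    · exfalso
      push Not at hM
      have two : ∀ i, walkColours (unroll N hN c) y i = none ∨
          walkColours (unroll N hN c) y i = some (c ⟨N - 1, by omega⟩ ⟨0, by omega⟩) := by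
        intro i
        have m0 := hM i.castSucc
        have m1 := hM i.succ
        have l1 : (y i.castSucc).val < (y i.succ).val := hy Fin.castSucc_lt_succ
        simp only [walkColours]
        generalize y i.castSucc = a at *
        generalize y i.succ = b at *
        unfold unroll
        split_ifs <;> first | omega | simp
      have n01 : walkColours (unroll N hN c) y ⟨0, by omega⟩ ≠
          walkColours (unroll N hN c) y ⟨1, by omega⟩ := fun h => by
        simpa using hc h
      have n02 : walkColours (unroll N hN c) y ⟨0, by omega⟩ ≠
          walkColours (unroll N hN c) y ⟨2, by omega⟩ := fun h => by
        simpa using hc h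
      have n12 : walkColours (unroll N hN c) y ⟨1, by omega⟩ ≠
          walkColours (unroll N hN c) y ⟨2, by omega⟩ := fun h => by
        simpa using hc h
      rcases two ⟨0, by omega⟩ with h0 | h0 <;> rcases two ⟨1, by omega⟩ with h1 | h1 <;>
        rcases two ⟨2, by omega⟩ with h2 | h2 <;> rw [h0, h1] at n01 <;> rw [h0, h2] at n02 <;>
        rw [h1, h2] at n12 <;> simp at n01 n02 n12

lemma no_walk_two (m : ℕ) (hm : 2 ≤ m) (x : Fin (m + 1) → Fin 2) (hx : IsWalk (revT 2) x) :
    False := by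
  have h1 := hx ⟨0, by omega⟩
  have h2 := hx ⟨1, by omega⟩
  have e : (Fin.castSucc ⟨1, by omega⟩ : Fin (m + 1)) = Fin.succ ⟨0, by omega⟩ := rfl
  rw [e] at h2
  unfold revT at h1 h2
  omega

lemma four_le_f (l k : ℕ) (hl : 2 ≤ l) (hk : 3 ≤ k) : 4 ≤ f l k := by
  by_contra h
  have := f_mem l k (2 + 2) (by omega) _ (unroll 2 le_rfl (fun _ _ => ()))
  rcases unroll_good 2 l k hl hk le_rfl _ this with ⟨x, hx, _⟩ | ⟨x, hx, _⟩
  · exact no_walk_two l hl x hx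
  · exact no_walk_two k (by omega) x hx

/-- For all integers l ≥ 2 and k ≥ 3, there is a tournament with exactly
f(l,k) − 1 vertices such that every edge colouring of it contains an l-flash or a
k-rainbow. -/
theorem exists_bad_tournament (l k : ℕ) (hl : 2 ≤ l) (hk : 3 ≤ k) :
    ∃ r : Fin (f l k - 1) → Fin (f l k - 1) → Prop, IsTournament r ∧
      ∀ (α : Type) (c : Fin (f l k - 1) → Fin (f l k - 1) → α),
        HasFlash l r c ∨ HasRainbow k r c := by
  have h4 := four_le_f l k hl hk
  refine ⟨revT _, revT_tournament _ (by omega), fun α c => ?_⟩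
  exact unroll_good _ l k hl hk (by omega) c
    (f_mem l k (f l k - 1 + 2) (by omega) _ (unroll _ (by omega) c))
end

section
/- There is a constant C > 0 such that for all positive integers l and k ≥ 2, every tournament with at most C · l^{k-2}/√k vertices admits an edge colouring that contains neither an l-flash nor a k-rainbow. -/
/-- Centred coordinate sum. -/
def cSum (l d : ℕ) (x : Fin d → Fin l) : ℤ := ∑ i, (2 * ((x i : ℕ) : ℤ) - (l - 1))

lemma sum_centre (l : ℕ) : ∑ a : Fin l, (2 * ((a : ℕ) : ℤ) - (l - 1)) = 0 := by
  have h : ∑ a : Fin l, (2 * ((a : ℕ) : ℤ) - (l - 1))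
      = ∑ a : Fin l, -(2 * ((a : ℕ) : ℤ) - (l - 1)) := by
    rw [← Equiv.sum_comp Fin.revPerm]
    refine Finset.sum_congr rfl fun a _ => ?_
    have := a.2
    simp only [Fin.revPerm_apply, Fin.val_rev]
    push_cast [Nat.succ_le_of_lt this]
    ring
  rw [Finset.sum_neg_distrib] at h
  linarith

lemma cSum_cons (l d : ℕ) (a : Fin l) (x : Fin d → Fin l) :
    cSum l (d + 1) (Fin.cons a x : Fin (d + 1) → Fin l)
      = (2 * ((a : ℕ) : ℤ) - (l - 1)) + cSum l d x := by
  simp only [cSum, Fin.sum_univ_succ, Fin.cons_zero, Fin.cons_succ]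

lemma sum_cons (l d : ℕ) (F : (Fin (d + 1) → Fin l) → ℤ) :
    ∑ x, F x = ∑ a : Fin l, ∑ x : Fin d → Fin l, F (Fin.cons a x : Fin (d + 1) → Fin l) := by
  rw [← Equiv.sum_comp (Fin.consEquiv (fun _ : Fin (d + 1) => Fin l)), Fintype.sum_prod_type]
  rfl

lemma sum_cSum (l d : ℕ) : ∑ x : Fin d → Fin l, cSum l d x = 0 := by
  induction d with
  | zero => simp [cSum]
  | succ d ih =>
    rw [sum_cons]
    simp only [cSum_cons, Finset.sum_add_distrib, ih]
    simp only [Finset.sum_const, ← Finset.smul_sum, sum_centre]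
    simp

lemma sum_cSum_sq (l d : ℕ) :
    ∑ x : Fin d → Fin l, (cSum l d x) ^ 2 ≤ (d : ℤ) * l ^ 2 * l ^ d := by
  induction d with
  | zero => simp [cSum]
  | succ d ih =>
    rw [sum_cons]
    have h : ∀ a : Fin l, ∑ x : Fin d → Fin l,
        (cSum l (d + 1) (Fin.cons a x : Fin (d + 1) → Fin l)) ^ 2
        ≤ (l : ℤ) ^ 2 * l ^ d + (d : ℤ) * l ^ 2 * l ^ d := by
      intro a
      have e : ∀ x : Fin d → Fin l,
          (cSum l (d + 1) (Fin.cons a x : Fin (d + 1) → Fin l)) ^ 2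
          = (2 * ((a : ℕ) : ℤ) - (l - 1)) ^ 2
            + 2 * (2 * ((a : ℕ) : ℤ) - (l - 1)) * cSum l d x + (cSum l d x) ^ 2 := by
        intro x; rw [cSum_cons]; ring
      simp only [e, Finset.sum_add_distrib, ← Finset.mul_sum, sum_cSum]
      have ha : (2 * ((a : ℕ) : ℤ) - (l - 1)) ^ 2 ≤ (l : ℤ) ^ 2 := by
        have := a.2
        apply sq_le_sq'  <;> omega
      have : ∑ x : Fin d → Fin l, (2 * ((a : ℕ) : ℤ) - (l - 1)) ^ 2 ≤ (l : ℤ) ^ 2 * l ^ d := by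
        simp only [Finset.sum_const, Finset.card_univ, Fintype.card_fun, Fintype.card_fin,
          nsmul_eq_mul]
        push_cast
        rw [mul_comm]
        gcongr
      linarith
    calc _ ≤ ∑ a : Fin l, ((l : ℤ) ^ 2 * l ^ d + (d : ℤ) * l ^ 2 * l ^ d) :=
          Finset.sum_le_sum fun a _ => h a
      _ = _ := by
        simp only [Finset.sum_const, Finset.card_univ, Fintype.card_fin, nsmul_eq_mul]
        push_cast
        ring

lemma exists_layer (l d m : ℕ) (hl : 0 < l) (hm : 0 < m) (hdm : d ≤ m ^ 2) :
    ∃ s : ℤ, (3 : ℝ) * l ^ d / (16 * l * m)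
      ≤ ((Finset.univ.filter fun x : Fin d → Fin l => cSum l d x = s).card : ℝ) := by
  classical
  set N : ℤ := 2 * l * m with hN
  have hNpos : 0 < N := by positivity
  set G := Finset.univ.filter fun x : Fin d → Fin l => cSum l d x ∈ Finset.Ioo (-N) N with hG
  set B := Finset.univ.filter fun x : Fin d → Fin l => ¬ cSum l d x ∈ Finset.Ioo (-N) N with hB
  have hGB : G.card + B.card = l ^ d := by
    rw [hG, hB, Finset.card_filter_add_card_filter_not]
    simp
  have hBc : (B.card : ℤ) * N ^ 2 ≤ (d : ℤ) * l ^ 2 * l ^ d := by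
    calc (B.card : ℤ) * N ^ 2 = ∑ x ∈ B, N ^ 2 := by simp
      _ ≤ ∑ x ∈ B, (cSum l d x) ^ 2 := by
        refine Finset.sum_le_sum fun x hx => ?_
        rw [hB, Finset.mem_filter, Finset.mem_Ioo] at hx
        apply sq_le_sq.mpr
        rw [abs_of_pos hNpos, le_abs]
        by_contra hc
        push Not at hc
        exact hx.2 ⟨by linarith [hc.2], hc.1⟩
      _ ≤ ∑ x : Fin d → Fin l, (cSum l d x) ^ 2 :=
        Finset.sum_le_sum_of_subset_of_nonneg (Finset.subset_univ _) fun _ _ _ => sq_nonneg _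
      _ ≤ _ := sum_cSum_sq l d
  have hB4 : 4 * (B.card : ℤ) ≤ l ^ d := by
    have h1 : (d : ℤ) * l ^ 2 * l ^ d ≤ (m : ℤ) ^ 2 * l ^ 2 * l ^ d := by
      gcongr
      exact_mod_cast hdm
    have h2 : (4 * (B.card : ℤ)) * ((l : ℤ) ^ 2 * m ^ 2) ≤ (l : ℤ) ^ d * ((l : ℤ) ^ 2 * m ^ 2) := by
      rw [hN] at hBc
      nlinarith
    exact le_of_mul_le_mul_right h2 (by positivity)
  have hB4' : 4 * (B.card : ℝ) ≤ (l : ℝ) ^ d := by exact_mod_cast hB4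
  have hGB' : (G.card : ℝ) + B.card = (l : ℝ) ^ d := by exact_mod_cast hGB
  have hl' : (0 : ℝ) < l := by exact_mod_cast hl
  have hm' : (0 : ℝ) < m := by exact_mod_cast hm
  obtain ⟨s, hs, hle⟩ := Finset.exists_le_card_fiber_of_nsmul_le_card_of_maps_to
    (s := G) (t := Finset.Ioo (-N) N) (f := cSum l d) (b := (3 : ℝ) * l ^ d / (16 * l * m))
    (fun x hx => (Finset.mem_filter.mp hx).2) ⟨0, by simp [hNpos]⟩ (by
      rw [Int.card_Ioo, nsmul_eq_mul]
      have : (((N - -N - 1).toNat : ℕ) : ℝ) ≤ 4 * l * m := by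
        have : (N - -N - 1).toNat ≤ 4 * l * m := by
          zify
          rw [Int.toNat_of_nonneg (by omega)]
          linarith
        exact_mod_cast this
      calc _ ≤ (4 * l * m : ℝ) * ((3 : ℝ) * l ^ d / (16 * l * m)) := by gcongr
        _ = 3 / 4 * (l : ℝ) ^ d := by field_simp; ring
        _ ≤ _ := by linarith)
  refine ⟨s, hle.trans ?_⟩
  gcongr
  exact Finset.subset_univ _

lemma colouring_of_card (l d n : ℕ) (hl : 0 < l) (s : ℤ)
    (hn : n ≤ (Finset.univ.filter fun x : Fin d → Fin l => cSum l d x = s).card)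
    (r : Fin n → Fin n → Prop) (hr : IsTournament r) :
    ∃ c : Fin n → Fin n → ℕ, ¬ HasFlash l r c ∧ ¬ HasRainbow (d + 1) r c := by
  classical
  set A := Finset.univ.filter fun x : Fin d → Fin l => cSum l d x = s with hA
  obtain ⟨p⟩ : Nonempty (Fin n ↪ A) := by
    rw [Function.Embedding.nonempty_iff_card_le]
    simpa using hn
  have key : ∀ u v, r u v → ∃ i, (p u : Fin d → Fin l) i < (p v : Fin d → Fin l) i := by
    intro u v huv
    by_contra hc
    push Not at hc
    have hne : u ≠ v := fun h => hr.1 v (h ▸ huv)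
    have hu : cSum l d (p u) = s := (Finset.mem_filter.mp (p u).2).2
    have hv : cSum l d (p v) = s := (Finset.mem_filter.mp (p v).2).2
    have hle : ∀ i ∈ Finset.univ, (2 * (((p v : Fin d → Fin l) i : ℕ) : ℤ) - (l - 1))
        ≤ (2 * (((p u : Fin d → Fin l) i : ℕ) : ℤ) - (l - 1)) := by
      intro i _
      have : ((p v : Fin d → Fin l) i : ℕ) ≤ ((p u : Fin d → Fin l) i : ℕ) := hc i
      omega
    have heq := (Finset.sum_eq_sum_iff_of_le hle).mp (hv.trans hu.symm)
    apply hne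
    apply p.injective
    apply Subtype.ext
    funext i
    apply Fin.ext
    have := heq i (Finset.mem_univ _)
    omega
  choose g hg using key
  refine ⟨fun u v => if h : r u v then (g u v h : ℕ) else 0, ?_, ?_⟩
  · rintro ⟨x, hw, hc⟩
    let i0 : Fin d := g _ _ (hw ⟨0, hl⟩)
    have hall : ∀ j : Fin l, g _ _ (hw j) = i0 := by
      intro j
      have := hc j ⟨0, hl⟩
      simp only [walkColours] at this
      rw [dif_pos (hw j), dif_pos (hw ⟨0, hl⟩)] at this
      exact Fin.ext this
    have hmono : StrictMono fun j => (p (x j) : Fin d → Fin l) i0 := by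
      rw [Fin.strictMono_iff_lt_succ]
      intro j
      have := hg _ _ (hw j)
      rwa [hall j] at this
    have := Fintype.card_le_of_injective _ hmono.injective
    simp at this
  · rintro ⟨y, hw, hinj⟩
    have : Function.Injective fun j : Fin (d + 1) => g _ _ (hw j) := by
      intro a b hab
      apply hinj
      simp only [walkColours]
      rw [dif_pos (hw a), dif_pos (hw b)]
      exact congrArg Fin.val hab
    have := Fintype.card_le_of_injective _ this
    simp at this

/-- There is a constant C > 0 such that for all positive integers l and k ≥ 2,
every tournament with at most C · l^{k-2}/√k vertices has an edge colouring with
neither l-flashes nor k-rainbows. -/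
theorem small_tournament_good_colouring :
    ∃ C : ℝ, 0 < C ∧ ∀ l k : ℕ, 0 < l → 2 ≤ k →
      ∀ n : ℕ, (n : ℝ) ≤ C * (l : ℝ) ^ (k - 2) / Real.sqrt k →
        ∀ r : Fin n → Fin n → Prop, IsTournament r →
          ∃ c : Fin n → Fin n → ℕ, ¬ HasFlash l r c ∧ ¬ HasRainbow k r c := by
  refine ⟨3 / 32, by norm_num, ?_⟩
  intro l k hl hk n hn r hr
  obtain ⟨e, rfl⟩ : ∃ e, k = e + 2 := ⟨k - 2, by omega⟩
  have hl' : (0 : ℝ) < l := by exact_mod_cast hl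
  set m := Nat.sqrt (e + 1) + 1 with hm
  have hm' : (0 : ℝ) < m := by positivity
  obtain ⟨s, hs⟩ := exists_layer l (e + 1) m hl (by omega) (Nat.lt_succ_sqrt' _).le
  have hk1 : (1 : ℝ) ≤ Real.sqrt ((e + 2 : ℕ) : ℝ) := by
    rw [Real.one_le_sqrt]; push_cast; linarith [(Nat.cast_nonneg e : (0 : ℝ) ≤ e)]
  have hk2 : (m : ℝ) ≤ 2 * Real.sqrt ((e + 2 : ℕ) : ℝ) := by
    have : ((Nat.sqrt (e + 1) : ℕ) : ℝ) ≤ Real.sqrt ((e + 2 : ℕ) : ℝ) := by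
      apply Real.le_sqrt_of_sq_le
      have h1 := Nat.sqrt_le' (e + 1)
      exact_mod_cast h1.trans (by omega)
    rw [hm]; push_cast at *; linarith
  refine colouring_of_card l (e + 1) n hl s ?_ r hr
  have : (n : ℝ) ≤ (3 : ℝ) * l ^ (e + 1) / (16 * l * m) := by
    refine hn.trans ?_
    rw [Nat.add_sub_cancel]
    rw [div_le_div_iff₀ (by linarith) (by positivity), pow_succ]
    have hp : (0 : ℝ) ≤ (l : ℝ) ^ e * l := by positivity
    nlinarith [mul_le_mul_of_nonneg_left hk2 hp]
  exact_mod_cast this.trans hs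
end

section
/- Let l be a positive integer, let c be a non-negative integer, and let T = (V, E) be an edge-coloured tournament containing no l-flash in which every vertex has at most c distinct colours on its incoming edges and at most c distinct colours on its outgoing edges. Then |V| ≤ (1 + 2/√l)^c · l^c. -/
/-- The set of colours on edges directed into `v`. -/
def inColours {n : ℕ} {α : Type} (r : Fin n → Fin n → Prop) (c : Fin n → Fin n → α)
    (v : Fin n) : Set α :=
  {a | ∃ u, r u v ∧ c u v = a}

open Classical in
/-- Disjoint boxes have total weight at most one. -/
theorem aux_boxes {V ι K : Type} [Fintype V] [Fintype ι] [Fintype K]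
    (L : V → ι → Option K) (p : K → ℝ) (hp : ∀ i, 0 ≤ p i) (hs : ∑ i, p i = 1)
    (hd : ∀ u v, u ≠ v → ∃ a i j, i ≠ j ∧ L u a = some i ∧ L v a = some j) :
    ∑ v, ∏ a, (L v a).elim 1 p ≤ 1 := by
  let B : V → ι → Finset K := fun v a => (L v a).elim Finset.univ (fun i => {i})
  have hB : ∀ v a, ∑ i ∈ B v a, p i = (L v a).elim 1 p := by
    intro v a
    simp only [B]
    cases L v a <;> simp [hs]
  have h1 : ∀ v, ∏ a, (L v a).elim 1 p = ∑ X ∈ Fintype.piFinset (B v), ∏ a, p (X a) := by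
    intro v
    rw [← Finset.prod_univ_sum]
    exact Finset.prod_congr rfl (fun a _ => (hB v a).symm)
  have hdisj : ∀ u ∈ (Finset.univ : Finset V), ∀ v ∈ (Finset.univ : Finset V), u ≠ v →
      Disjoint (Fintype.piFinset (B u)) (Fintype.piFinset (B v)) := by
    intro u _ v _ huv
    obtain ⟨a, i, j, hij, hu, hv⟩ := hd u v huv
    rw [Finset.disjoint_left]
    intro X hXu hXv
    have e1 := Fintype.mem_piFinset.1 hXu a
    have e2 := Fintype.mem_piFinset.1 hXv a
    simp only [B, hu, hv, Option.elim, Finset.mem_singleton] at e1 e2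
    exact hij (e1.symm.trans e2)
  simp_rw [h1]
  rw [← Finset.sum_biUnion (by
    intro u hu v hv huv
    exact hdisj u (Finset.mem_univ _) v (Finset.mem_univ _) huv)]
  calc _ ≤ ∑ X : ι → K, ∏ a, p (X a) :=
        Finset.sum_le_sum_of_subset_of_nonneg (Finset.subset_univ _)
          (fun X _ _ => Finset.prod_nonneg (fun a _ => hp _))
    _ = ∏ _a : ι, ∑ i, p i := by
        rw [Finset.prod_univ_sum, Fintype.piFinset_univ]
    _ = 1 := by simp [hs]

/-- There is a walk of length `m` in colour `a` ending at `v`. -/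
def EndsWalk {n : ℕ} {α : Type} (r : Fin n → Fin n → Prop) (c : Fin n → Fin n → α) (a : α) :
    ℕ → Fin n → Prop
  | 0, _ => True
  | m + 1, v => ∃ u, r u v ∧ c u v = a ∧ EndsWalk r c a m u

theorem EndsWalk.exists_walk {n : ℕ} {α : Type} {r : Fin n → Fin n → Prop}
    {c : Fin n → Fin n → α} {a : α} (m : ℕ) : ∀ v, EndsWalk r c a m v →
    ∃ x : Fin (m + 1) → Fin n, IsWalk r x ∧ (∀ i, walkColours c x i = a) ∧
      x (Fin.last m) = v := by
  induction m with
  | zero => intro v _; exact ⟨fun _ => v, fun i => i.elim0, fun i => i.elim0, rfl⟩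
  | succ m ih =>
    rintro v ⟨u, hr, hc, hu⟩
    obtain ⟨x, hx, hxc, hl⟩ := ih u hu
    refine ⟨Fin.snoc (α := fun _ => Fin n) x v, ?_, ?_, by simp⟩
    · intro i
      refine Fin.lastCases ?_ (fun i => ?_) i
      · simpa [hl] using hr
      · rw [Fin.succ_castSucc, Fin.snoc_castSucc, Fin.snoc_castSucc]; exact hx i
    · intro i
      refine Fin.lastCases ?_ (fun i => ?_) i
      · simpa [walkColours, hl] using hc
      · have := hxc i
        unfold walkColours at this ⊢
        rw [Fin.succ_castSucc, Fin.snoc_castSucc, Fin.snoc_castSucc]; exact this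

theorem not_endsWalk {n l : ℕ} {α : Type} {r : Fin n → Fin n → Prop}
    {c : Fin n → Fin n → α} (hf : ¬ HasFlash l r c) (a : α) (v : Fin n) :
    ¬ EndsWalk r c a l v := by
  intro h
  obtain ⟨x, hx, hc, _⟩ := EndsWalk.exists_walk l v h
  exact hf ⟨x, hx, fun i j => (hc i).trans (hc j).symm⟩

open Classical in
theorem aux_level {n l : ℕ} {α : Type} {r : Fin n → Fin n → Prop}
    {c : Fin n → Fin n → α} (hf : ¬ HasFlash (l + 2) r c) :
    ∃ g : Fin n → α → Fin (l + 2),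
      (∀ u v, r u v → g u (c u v) < g v (c u v)) ∧
      (∀ v a, a ∉ outColours r c v → g v a = Fin.last (l + 1)) ∧
      (∀ v a, a ∉ inColours r c v → a ∈ outColours r c v → g v a = 0) := by
  let h : Fin n → α → ℕ := fun v a => Nat.findGreatest (fun m => EndsWalk r c a m v) (l + 1)
  have hlt : ∀ v a, h v a < l + 2 := fun v a => Nat.lt_succ_of_le (Nat.findGreatest_le _)
  have hspec : ∀ v a, EndsWalk r c a (h v a) v := fun v a =>
    Nat.findGreatest_spec (P := fun m => EndsWalk r c a m v) (Nat.zero_le _) trivial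
  refine ⟨fun v a => if a ∈ outColours r c v then ⟨h v a, hlt v a⟩ else Fin.last (l + 1),
    ?_, ?_, ?_⟩
  · intro u v huv
    have hu : c u v ∈ outColours r c u := ⟨v, huv, rfl⟩
    have hw : EndsWalk r c (c u v) (h u (c u v) + 1) v := ⟨u, huv, rfl, hspec _ _⟩
    have hle : h u (c u v) + 1 ≤ l + 1 := by
      by_contra hcon
      have : h u (c u v) + 1 = l + 2 := by have := hlt u (c u v); omega
      rw [this] at hw
      exact not_endsWalk hf _ _ hw
    have hlev : h u (c u v) + 1 ≤ h v (c u v) :=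
      Nat.le_findGreatest (P := fun m => EndsWalk r c (c u v) m v) hle hw
    simp only [if_pos hu]
    split_ifs
    · rw [Fin.lt_def]; exact hlev
    · rw [Fin.lt_def]; exact hle
  · intro v a ha
    simp [ha]
  · intro v a hi ho
    simp only [if_pos ho]
    have := hspec v a
    have h0 : h v a = 0 := by
      cases hh : h v a with
      | zero => rfl
      | succ k =>
        rw [hh] at this
        obtain ⟨u, hr, hc, _⟩ := this
        exact absurd ⟨u, hr, hc⟩ hi
    ext
    simpa using h0

theorem aux_prod {ι α : Type} [Fintype ι] (e : ι → α) (he : Function.Injective e)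
    (S : Set α) (hS : S.Finite) [DecidablePred (· ∈ S)] (cc : ℕ) (hc : S.ncard ≤ cc)
    (x : ℝ) (h0 : 0 ≤ x) (h1 : x ≤ 1) :
    x ^ cc ≤ ∏ a, (if e a ∈ S then x else 1) := by
  rw [Finset.prod_ite]
  simp only [Finset.prod_const, one_pow, mul_one]
  apply pow_le_pow_of_le_one h0 h1
  refine le_trans ?_ hc
  rw [← Finset.card_map ⟨e, he⟩, ← Set.ncard_coe_finset]
  apply Set.ncard_le_ncard _ hS
  intro y hy
  simp at hy
  obtain ⟨a, ha, rfl⟩ := hy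
  exact ha

open Classical in
theorem aux_main (l : ℕ) (cc : ℕ) (n : ℕ)
    (r : Fin n → Fin n → Prop) (α : Type) (c : Fin n → Fin n → α)
    (hT : IsTournament r) (hf : ¬ HasFlash (l + 2) r c)
    (hin : ∀ v, (inColours r c v).ncard ≤ cc)
    (hout : ∀ v, (outColours r c v).ncard ≤ cc)
    (x : ℝ) (hx0 : 0 < x) (hx1 : x ≤ 1) (hx : 2 * x + l * x ^ 2 = 1) :
    n * (x ^ cc * x ^ cc) ≤ 1 := by
  obtain ⟨g, hg, hgo, hgi⟩ := aux_level hf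
  let ι : Type := Set.range (fun q : Fin n × Fin n => c q.1 q.2)
  have : Fintype ι := Fintype.ofFinite _
  let p : Fin (l + 2) → ℝ := fun i => if i = 0 ∨ i = Fin.last (l + 1) then x else x ^ 2
  have hxx : x ^ 2 ≤ x := by nlinarith
  have hp2 : ∀ i, x ^ 2 ≤ p i := by
    intro i; simp only [p]; split_ifs
    · exact hxx
    · exact le_rfl
  have hp0 : ∀ i, 0 ≤ p i := fun i => le_trans (by positivity) (hp2 i)
  have hps : ∑ i, p i = 1 := by
    rw [Fin.sum_univ_succ, Fin.sum_univ_castSucc]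
    have e : ∀ i : Fin l, p (i.castSucc.succ) = x ^ 2 := by
      intro i
      simp only [p]
      rw [if_neg]
      rintro (h | h)
      · exact Fin.succ_ne_zero _ h
      · have := congrArg Fin.val h
        simp at this
        have := i.2
        omega
    have e0 : p 0 = x := by simp [p]
    have e1 : p (Fin.last l).succ = x := by simp [p]
    simp only [e, e0, e1, Finset.sum_const, Finset.card_univ, Fintype.card_fin, nsmul_eq_mul]
    linarith
  let L : Fin n → ι → Option (Fin (l + 2)) := fun v a =>
    if a.1 ∈ inColours r c v ∨ a.1 ∈ outColours r c v then some (g v a.1) else none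
  have key : ∀ u v, r u v → ∃ a i j, i ≠ j ∧ L u a = some i ∧ L v a = some j := by
    intro u v huv
    have hu : c u v ∈ outColours r c u := ⟨v, huv, rfl⟩
    have hv : c u v ∈ inColours r c v := ⟨u, huv, rfl⟩
    refine ⟨⟨c u v, ⟨(u, v), rfl⟩⟩, g u (c u v), g v (c u v), (hg u v huv).ne, ?_, ?_⟩
    · simp [L, hu]
    · simp [L, hv]
  have hd : ∀ u v, u ≠ v → ∃ a i j, i ≠ j ∧ L u a = some i ∧ L v a = some j := by
    intro u v huv
    by_cases h : r u v
    · exact key u v h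
    · have h' : r v u := by
        by_contra h2
        exact h ((hT.2 u v huv).2 h2)
      obtain ⟨a, i, j, hij, h1, h2⟩ := key v u h'
      exact ⟨a, j, i, hij.symm, h2, h1⟩
  have hsum := aux_boxes L p hp0 hps hd
  refine le_trans ?_ hsum
  have hfi : ∀ v, (inColours r c v).Finite := fun v =>
    (Set.finite_range (fun u => c u v)).subset (by rintro _ ⟨u, _, rfl⟩; exact ⟨u, rfl⟩)
  have hfo : ∀ v, (outColours r c v).Finite := fun v =>
    (Set.finite_range (fun u => c v u)).subset (by rintro _ ⟨u, _, rfl⟩; exact ⟨u, rfl⟩)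
  have hv : ∀ v, x ^ cc * x ^ cc ≤ ∏ a, (L v a).elim 1 p := by
    intro v
    calc x ^ cc * x ^ cc
        ≤ (∏ a : ι, (if a.1 ∈ inColours r c v then x else 1)) *
          (∏ a : ι, (if a.1 ∈ outColours r c v then x else 1)) := by
          apply mul_le_mul
          · exact aux_prod (fun a : ι => a.1) Subtype.val_injective _ (hfi v) cc (hin v) x
              hx0.le hx1
          · exact aux_prod (fun a : ι => a.1) Subtype.val_injective _ (hfo v) cc (hout v) x
              hx0.le hx1
          · positivity
          · exact Finset.prod_nonneg (fun a _ => by split_ifs <;> positivity)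
      _ = ∏ a : ι, ((if a.1 ∈ inColours r c v then x else 1) *
            (if a.1 ∈ outColours r c v then x else 1)) := by rw [Finset.prod_mul_distrib]
      _ ≤ _ := by
          apply Finset.prod_le_prod
          · intro a _
            split_ifs <;> positivity
          · intro a _
            by_cases hi : a.1 ∈ inColours r c v <;> by_cases ho : a.1 ∈ outColours r c v
            · have := hp2 (g v a.1)
              simpa [L, hi, ho, ← pow_two] using this
            · simp [L, hi, ho, hgo v a.1 ho, p]
            · simp [L, hi, ho, hgi v a.1 hi ho, p]
            · simp [L, hi, ho]
  calc (n : ℝ) * (x ^ cc * x ^ cc) = ∑ _v : Fin n, x ^ cc * x ^ cc := by simp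
    _ ≤ _ := Finset.sum_le_sum (fun v _ => hv v)

/-- If an edge-coloured tournament contains no l-flash and every vertex has at most
cc incoming colours and at most cc outgoing colours, then it has at most
(1 + 2/√l)^cc · l^cc vertices. -/
theorem card_le_of_few_colours (l : ℕ) (hl : 0 < l) (cc : ℕ) (n : ℕ)
    (r : Fin n → Fin n → Prop) (α : Type) (c : Fin n → Fin n → α)
    (hT : IsTournament r) (hf : ¬ HasFlash l r c)
    (hin : ∀ v, (inColours r c v).ncard ≤ cc)
    (hout : ∀ v, (outColours r c v).ncard ≤ cc) :
    (n : ℝ) ≤ (1 + 2 / Real.sqrt l) ^ cc * (l : ℝ) ^ cc := by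
  obtain rfl | ⟨m, rfl⟩ : l = 1 ∨ ∃ m, l = m + 2 := by
    rcases l with _ | _ | m
    · omega
    · left; rfl
    · right; exact ⟨m, rfl⟩
  · have hn : n ≤ 1 := by
      by_contra hcon
      have hne : (⟨0, by omega⟩ : Fin n) ≠ ⟨1, by omega⟩ := by simp
      have edge : ∀ u v, ¬ r u v := by
        intro u v huv
        refine not_endsWalk hf (c u v) v ⟨u, huv, rfl, trivial⟩
      exact edge _ _ ((hT.2 _ _ hne).2 (edge _ _))
    have h1 : (n : ℝ) ≤ 1 := by exact_mod_cast hn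
    refine h1.trans ?_
    simp only [Nat.cast_one, one_pow, mul_one, Real.sqrt_one]
    exact one_le_pow₀ (by norm_num)
  · set s : ℝ := Real.sqrt ((m : ℝ) + 1) with hs
    have hs2 : s ^ 2 = m + 1 := Real.sq_sqrt (by positivity)
    have hs0 : 0 ≤ s := Real.sqrt_nonneg _
    have hmain := aux_main m cc n r α c hT hf hin hout (1 / (1 + s)) (by positivity)
      (by rw [div_le_one (by positivity)]; linarith)
      (by field_simp; nlinarith)
    have h2 : (n : ℝ) ≤ ((1 + s) ^ 2) ^ cc := by
      have e : (1 / (1 + s)) ^ cc * (1 / (1 + s)) ^ cc = 1 / ((1 + s) ^ 2) ^ cc := by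
        rw [← mul_pow, ← pow_two, div_pow, div_pow, one_pow, one_pow]
      rw [e, mul_one_div, div_le_one (by positivity)] at hmain
      exact hmain
    refine h2.trans ?_
    rw [← mul_pow]
    apply pow_le_pow_left₀ (by positivity)
    have ht : s ≤ Real.sqrt ((m + 2 : ℕ) : ℝ) := by
      apply Real.sqrt_le_sqrt
      push_cast
      linarith
    have hlpos : (0 : ℝ) < ((m + 2 : ℕ) : ℝ) := by positivity
    have htp := Real.sqrt_pos.2 hlpos
    have ht2 := Real.sq_sqrt hlpos.le
    set t' : ℝ := Real.sqrt ((m + 2 : ℕ) : ℝ)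
    have e : (1 + 2 / t') * ((m + 2 : ℕ) : ℝ) = t' ^ 2 + 2 * t' := by
      rw [← ht2]; field_simp
    rw [e, ht2]
    push_cast
    nlinarith
end

section
/- For all positive integers l, for every k ≥ 2 and every integer r with 1 ≤ r < k, it holds that t(l,k) ≤ t(l,k-1) + g(l,k,r-1) + 1 + 2(k-1) · l^r · t(l,k-r). -/
/-- A directed walk from `u` to `w` whose list of colours is `L`. -/
inductive Tr {V α : Type} (r : V → V → Prop) (c : V → V → α) : V → List α → V → Prop
  | nil (u : V) : Tr r c u [] u
  | cons {u v w : V} {L : List α} : r u v → Tr r c v L w → Tr r c u (c u v :: L) w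

theorem Tr.append {V α : Type} {r : V → V → Prop} {c : V → V → α} {u v w : V} {L M : List α}
    (h : Tr r c u L v) (h' : Tr r c v M w) : Tr r c u (L ++ M) w := by
  induction h with
  | nil u => exact h'
  | cons e _ ih => exact Tr.cons e (ih h')

theorem Tr.single {V α : Type} {r : V → V → Prop} {c : V → V → α} {u v : V}
    (h : r u v) : Tr r c u [c u v] v := Tr.cons h (Tr.nil v)

theorem Tr.mono {V α : Type} {r r' : V → V → Prop} {c : V → V → α} {u w : V} {L : List α}
    (hr : ∀ a b, r a b → r' a b) (h : Tr r c u L w) : Tr r' c u L w := by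
  induction h with
  | nil u => exact Tr.nil u
  | cons e _ ih => exact Tr.cons (hr _ _ e) ih

theorem Tr.colour_mem {V α : Type} {r : V → V → Prop} {c : V → V → α} {u w : V} {L : List α}
    (h : Tr r c u L w) : ∀ a ∈ L, ∃ x y, r x y ∧ c x y = a := by
  induction h with
  | nil u => simp
  | cons e _ ih =>
    intro a ha
    rcases List.mem_cons.1 ha with rfl | ha
    · exact ⟨_, _, e, rfl⟩
    · exact ih a ha

theorem Tr.map {V W α : Type} {r : V → V → Prop} {c : V → V → α} {s : W → W → Prop}
    {d : W → W → α} (e : W → V) (hs : ∀ a b, s a b → r (e a) (e b))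
    (hd : ∀ a b, d a b = c (e a) (e b))
    {u w : W} {L : List α} (h : Tr s d u L w) : Tr r c (e u) L (e w) := by
  induction h with
  | nil u => exact Tr.nil _
  | cons he _ ih =>
    rw [hd]
    exact Tr.cons (hs _ _ he) ih

theorem Tr.of_walk {n : ℕ} {α : Type} {r : Fin n → Fin n → Prop} {c : Fin n → Fin n → α} :
    ∀ {m : ℕ} (x : Fin (m + 1) → Fin n), IsWalk r x →
      Tr r c (x 0) (List.ofFn (walkColours c x)) (x (Fin.last m)) := by
  intro m
  induction m with
  | zero => intro x _; simpa using Tr.nil (x 0)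
  | succ m ih =>
    intro x hx
    have h1 := ih (fun i => x i.succ) (fun i => hx i.succ)
    rw [List.ofFn_succ]
    exact Tr.cons (hx 0) h1

theorem Tr.to_walk {n : ℕ} {α : Type} {r : Fin n → Fin n → Prop} {c : Fin n → Fin n → α}
    {u w : Fin n} {L : List α} (h : Tr r c u L w) :
    ∃ x : Fin (L.length + 1) → Fin n, IsWalk r x ∧ x 0 = u ∧ x (Fin.last _) = w ∧
      walkColours c x = L.get := by
  induction h with
  | nil u => exact ⟨fun _ => u, fun i => i.elim0, rfl, rfl, funext fun i => i.elim0⟩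
  | @cons u v w L e _ ih =>
    obtain ⟨x, hx, h0, hl, hc⟩ := ih
    refine ⟨Fin.cons u x, ?_, rfl, ?_, ?_⟩
    · intro i
      refine Fin.cases ?_ (fun j => ?_) i
      · simpa [h0] using e
      · exact hx j
    · exact hl
    · funext i
      refine Fin.cases ?_ (fun j => ?_) i
      · simp [walkColours, h0]
      · exact congrFun hc j

theorem hasRainbow_iff {n : ℕ} {α : Type} {r : Fin n → Fin n → Prop} {c : Fin n → Fin n → α}
    {k : ℕ} : HasRainbow k r c ↔ ∃ u w L, Tr r c u L w ∧ L.Nodup ∧ L.length = k := by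
  constructor
  · rintro ⟨y, hy, hi⟩
    exact ⟨_, _, _, Tr.of_walk y hy, List.nodup_ofFn.2 hi, by simp⟩
  · rintro ⟨u, w, L, h, hn, rfl⟩
    obtain ⟨x, hx, _, _, hc⟩ := h.to_walk
    exact ⟨x, hx, by rw [hc]; exact List.nodup_iff_injective_get.1 hn⟩

theorem hasFlash_of_tr {n : ℕ} {α : Type} {r : Fin n → Fin n → Prop} {c : Fin n → Fin n → α}
    {L : List α} {a : α} {u w : Fin n} (h : Tr r c u L w) (ha : ∀ b ∈ L, b = a) :
    HasFlash L.length r c := by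
  obtain ⟨x, hx, _, _, hc⟩ := h.to_walk
  refine ⟨x, hx, fun i j => ?_⟩
  rw [hc, ha _ (L.get_mem i), ha _ (L.get_mem j)]

theorem hasFlash_of_map {n N : ℕ} {α : Type} {r : Fin n → Fin n → Prop}
    {c : Fin n → Fin n → α} {l : ℕ} (e : Fin N → Fin n)
    (h : HasFlash l (fun a b => r (e a) (e b)) (fun a b => c (e a) (e b))) :
    HasFlash l r c := by
  obtain ⟨x, hx, h⟩ := h
  exact ⟨e ∘ x, hx, h⟩

theorem isTournament_map {n N : ℕ} {r : Fin n → Fin n → Prop} (hr : IsTournament r)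
    (e : Fin N → Fin n) (he : Function.Injective e) :
    IsTournament (fun a b => r (e a) (e b)) :=
  ⟨fun v => hr.1 _, fun u v huv => hr.2 _ _ (fun h => huv (he h))⟩

theorem t_spec {l k n : ℕ} {α : Type} (hne : (tSet l k).Nonempty) {r : Fin n → Fin n → Prop}
    (hr : IsTournament r) (c : Fin n → Fin n → α) (S : Finset (Fin n)) (hS : t l k < S.card)
    (hf : ¬ HasFlash l r c) :
    ∃ u w L, u ∈ S ∧ w ∈ S ∧ Tr (fun a b => r a b ∧ a ∈ S ∧ b ∈ S) c u L w ∧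
      L.Nodup ∧ L.length = k := by
  have hm : t l k ∈ tSet l k := Nat.sInf_mem hne
  let e : Fin S.card → Fin n := S.orderEmbOfFin rfl
  have he : ∀ i, e i ∈ S := fun i => S.orderEmbOfFin_mem rfl i
  rcases hm S.card hS _ (isTournament_map hr e (S.orderEmbOfFin rfl).injective) α
    (fun a b => c (e a) (e b)) with h | h
  · exact absurd (hasFlash_of_map e h) hf
  · obtain ⟨u, w, L, h, hn, hL⟩ := hasRainbow_iff.1 h
    exact ⟨e u, e w, L, he _, he _,
      h.map e (fun a b hab => ⟨hab, he _, he _⟩) (fun _ _ => rfl), hn, hL⟩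

theorem g_spec {l k q n : ℕ} {α : Type} (hne : (gSet l k q).Nonempty)
    {r : Fin n → Fin n → Prop}
    (hr : IsTournament r) (c : Fin n → Fin n → α) (S : Finset (Fin n)) (hS : g l k q < S.card)
    (hout : ∀ v ∈ S, (outColours r c v).ncard ≤ k - 1)
    (hf : ¬ HasFlash l r c) (hk : ¬ HasRainbow k r c) :
    ∃ v ∈ S, IsInRobust q r c v := by
  have hm : g l k q ∈ gSet l k q := Nat.sInf_mem hne
  let e : Fin S.card → Fin n := S.orderEmbOfFin rfl
  have he : ∀ i, e i ∈ S := fun i => S.orderEmbOfFin_mem rfl i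
  have hsub : ∀ v, (outColours (fun a b => r (e a) (e b)) (fun a b => c (e a) (e b)) v).ncard
      ≤ k - 1 := by
    intro v
    refine le_trans (Set.ncard_le_ncard ?_ ?_) (hout (e v) (he v))
    · rintro a ⟨u, hu, rfl⟩
      exact ⟨e u, hu, rfl⟩
    · refine (Set.finite_range (fun u => c (e v) u)).subset ?_
      rintro a ⟨u, _, rfl⟩
      exact ⟨u, rfl⟩
  rcases hm S.card hS _ (isTournament_map hr e (S.orderEmbOfFin rfl).injective) α
    (fun a b => c (e a) (e b)) hsub with h | h | ⟨v, h⟩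
  · exact absurd (hasFlash_of_map e h) hf
  · obtain ⟨y, hy, hi⟩ := h
    exact absurd ⟨e ∘ y, hy, hi⟩ hk
  · refine ⟨e v, he v, fun a => ?_⟩
    obtain ⟨y, hy, hi, ha, hv⟩ := h a
    exact ⟨e ∘ y, hy, hi, ha, congrArg e hv⟩

theorem tSet_anti {l j k : ℕ} (hjk : j ≤ k) : tSet l k ⊆ tSet l j := by
  intro m hm n hn r hr α c
  refine (hm n hn r hr α c).imp_right ?_
  rintro ⟨y, hy, hi⟩
  refine ⟨fun i => y ⟨i, by omega⟩, fun i => hy ⟨i, by omega⟩, fun a b hab => ?_⟩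
  have := @hi ⟨a, by omega⟩ ⟨b, by omega⟩ hab
  simpa [Fin.ext_iff] using this

theorem tSet_sub_gSet {l k q : ℕ} : tSet l k ⊆ gSet l k q := by
  intro m hm n hn r hr α c _
  exact (hm n hn r hr α c).imp_right Or.inl

open Classical in
theorem exists_large_out {n : ℕ} {r : Fin n → Fin n → Prop} (hr : IsTournament r)
    (R : Finset (Fin n)) (M : ℕ) (hR : 1 + 2 * M < R.card) :
    ∃ v ∈ R, M < (R.filter (fun u => r v u)).card := by
  by_contra hcon
  push Not at hcon
  have hsum : ∑ v ∈ R, (R.filter (fun u => r v u)).card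
      = ∑ v ∈ R, (R.filter (fun u => r u v)).card :=
    Finset.sum_card_bipartiteAbove_eq_sum_card_bipartiteBelow r
  have hin : ∀ v ∈ R, M < (R.filter (fun u => r u v)).card := by
    intro v hv
    have h1 : R ⊆ R.filter (fun u => r v u) ∪ R.filter (fun u => r u v) ∪ {v} := by
      intro u hu
      by_cases huv : u = v
      · simp [huv]
      · have := hr.2 u v huv
        simp only [Finset.mem_union, Finset.mem_filter, Finset.mem_singleton]
        tauto
    have h2 := (Finset.card_le_card h1).trans (Finset.card_union_le _ _)
    have h3 := Finset.card_union_le (R.filter (fun u => r v u)) (R.filter (fun u => r u v))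
    have h4 := hcon v hv
    simp only [Finset.card_singleton] at h2
    omega
  have : ∑ v ∈ R, (R.filter (fun u => r v u)).card
      < ∑ v ∈ R, (R.filter (fun u => r u v)).card := by
    refine Finset.sum_lt_sum (fun v hv => (hcon v hv).trans (hin v hv).le) ?_
    obtain ⟨v, hv⟩ := Finset.card_pos.1 (show 0 < R.card by omega)
    exact ⟨v, hv, (hcon v hv).trans_lt (hin v hv)⟩
  omega

/-- There is an `a`-coloured walk of length `m` ending at `w`. -/
def EndsAt {n : ℕ} {α : Type} (r : Fin n → Fin n → Prop) (c : Fin n → Fin n → α) (a : α)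
    (w : Fin n) (m : ℕ) : Prop :=
  ∃ u L, Tr r c u L w ∧ (∀ b ∈ L, b = a) ∧ L.length = m

open Classical in
/-- The length of a longest `a`-coloured walk ending at `w` (with length at most `l - 1`). -/
noncomputable def label {n : ℕ} {α : Type} (l : ℕ) (r : Fin n → Fin n → Prop)
    (c : Fin n → Fin n → α) (a : α) (w : Fin n) : ℕ :=
  Nat.findGreatest (EndsAt r c a w) (l - 1)

theorem label_lt_label {n l : ℕ} {α : Type} (hl : 0 < l) {r : Fin n → Fin n → Prop}
    {c : Fin n → Fin n → α} (hf : ¬ HasFlash l r c) {u w : Fin n} (h : r u w) :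
    label l r c (c u w) u < label l r c (c u w) w := by
  classical
  have h0 : EndsAt r c (c u w) u (label l r c (c u w) u) := by
    unfold label
    exact Nat.findGreatest_spec (P := EndsAt r c (c u w) u) (Nat.zero_le _)
      ⟨u, [], Tr.nil u, by simp, rfl⟩
  have hle : label l r c (c u w) u ≤ l - 1 := Nat.findGreatest_le _
  obtain ⟨x, L, hT, hL, hlen⟩ := h0
  have h1 : Tr r c x (L ++ [c u w]) w := hT.append (Tr.single h)
  have h2 : ∀ b ∈ L ++ [c u w], b = c u w := by
    intro b hb
    rcases List.mem_append.1 hb with hb | hb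
    · exact hL b hb
    · simpa using hb
  have hne : label l r c (c u w) u + 1 ≠ l := by
    intro heq
    apply hf
    have := hasFlash_of_tr h1 h2
    rwa [show (L ++ [c u w]).length = l by simp [hlen, heq]] at this
  have : label l r c (c u w) u + 1 ≤ label l r c (c u w) w :=
    Nat.le_findGreatest (P := EndsAt r c (c u w) w) (by omega)
      ⟨x, _, h1, h2, by simp [hlen]⟩
  omega

/-- For every positive l, every k ≥ 2 and every r with 1 ≤ r < k,
t(l,k) ≤ t(l,k-1) + g(l,k,r-1) + 1 + 2(k-1) · l^r · t(l,k-r). -/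
theorem t_recursive_upper_bound (l k rb : ℕ) (hl : 0 < l) (hk : 2 ≤ k)
    (hr1 : 1 ≤ rb) (hrk : rb < k) :
    t l k ≤ t l (k - 1) + g l k (rb - 1) + 1 + 2 * (k - 1) * l ^ rb * t l (k - rb) := by
  classical
  rcases Set.eq_empty_or_nonempty (tSet l k) with h0 | hne
  · simp [t, h0]
  apply Nat.sInf_le
  intro n hn r hr α c
  by_contra hcon
  push Not at hcon
  obtain ⟨hf, hrain⟩ := hcon
  have hne1 : (tSet l (k - 1)).Nonempty := hne.mono (tSet_anti (by omega))
  have hne2 : (tSet l (k - rb)).Nonempty := hne.mono (tSet_anti (by omega))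
  have hne3 : (gSet l k (rb - 1)).Nonempty := hne.mono tSet_sub_gSet
  -- few vertices have many outgoing colours
  let A : Finset (Fin n) := Finset.univ.filter (fun v => k ≤ (outColours r c v).ncard)
  let B : Finset (Fin n) := Finset.univ.filter (fun v => ¬ k ≤ (outColours r c v).ncard)
  have hAB : A.card + B.card = n := by
    have := Finset.card_filter_add_card_filter_not (s := (Finset.univ : Finset (Fin n)))
      (fun v => k ≤ (outColours r c v).ncard)
    rwa [Finset.card_univ, Fintype.card_fin] at this
  have hA : A.card ≤ t l (k - 1) := by
    by_contra hA
    obtain ⟨u, w, L, -, hw, hT, hn, hL⟩ := t_spec hne1 hr c A (not_le.1 hA) hf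
    have hw' : k ≤ (outColours r c w).ncard := (Finset.mem_filter.1 hw).2
    have hcard : (L.toFinset : Set α).ncard < (outColours r c w).ncard := by
      rw [Set.ncard_coe_finset]
      have := L.toFinset_card_le
      omega
    obtain ⟨a, ⟨x, hx, rfl⟩, haL⟩ :=
      Set.exists_mem_notMem_of_ncard_lt_ncard hcard (Finset.finite_toSet _)
    refine hrain (hasRainbow_iff.2 ⟨u, x, L ++ [c w x],
      (hT.mono fun _ _ h => h.1).append (Tr.single hx), ?_, ?_⟩)
    · have haL' : c w x ∉ L := by simpa using haL
      rw [List.nodup_append']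
      exact ⟨hn, by simp, by simpa using haL'⟩
    · simp [hL]; omega
  have hBout : ∀ v ∈ B, (outColours r c v).ncard ≤ k - 1 := by
    intro v hv
    have := (Finset.mem_filter.1 hv).2
    omega
  -- many robust vertices
  let R := B.filter (fun v => IsInRobust (rb - 1) r c v)
  let Q := B.filter (fun v => ¬ IsInRobust (rb - 1) r c v)
  have hRQ : R.card + Q.card = B.card := Finset.card_filter_add_card_filter_not _
  have hQ : Q.card ≤ g l k (rb - 1) := by
    by_contra hQ
    obtain ⟨v, hv, hv'⟩ := g_spec hne3 hr c Q (not_le.1 hQ)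
      (fun v hv => hBout v (Finset.mem_filter.1 hv).1) hf hrain
    exact (Finset.mem_filter.1 hv).2 hv'
  have hR : 1 + 2 * ((k - 1) * (l ^ rb * t l (k - rb))) < R.card := by
    have : 2 * (k - 1) * l ^ rb * t l (k - rb) = 2 * ((k - 1) * (l ^ rb * t l (k - rb))) := by
      ring
    omega
  obtain ⟨v, hvR, hv⟩ := exists_large_out hr R _ hR
  have hvB := (Finset.mem_filter.1 hvR).1
  have hvrob := (Finset.mem_filter.1 hvR).2
  -- a popular colour
  have hfin : (outColours r c v).Finite := by
    refine (Set.finite_range (fun u => c v u)).subset ?_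
    rintro a ⟨u, _, rfl⟩
    exact ⟨u, rfl⟩
  obtain ⟨a, -, ha⟩ := Finset.exists_lt_card_fiber_of_mul_lt_card_of_maps_to
    (s := R.filter (fun u => r v u)) (t := hfin.toFinset) (f := fun u => c v u)
    (n := l ^ rb * t l (k - rb)) (by
      intro u hu
      simp only [Set.Finite.coe_toFinset, Set.Finite.mem_toFinset]
      exact ⟨u, (Finset.mem_filter.1 hu).2, rfl⟩)
    (lt_of_le_of_lt (Nat.mul_le_mul_right _ (by
      rw [← Set.ncard_eq_toFinset_card _ hfin]; exact hBout v hvB)) hv)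
  set S := (R.filter (fun u => r v u)).filter (fun u => c v u = a) with hSdef
  obtain ⟨y, hy, hyi, hya, hyv⟩ := hvrob a
  have hT1 : Tr r c (y 0) (List.ofFn (walkColours c y)) v := hyv ▸ Tr.of_walk y hy
  set L1 := List.ofFn (walkColours c y) with hL1
  have hn1 : L1.Nodup := List.nodup_ofFn.2 hyi
  have haL1 : a ∉ L1 := by
    rw [hL1, List.mem_ofFn]
    rintro ⟨i, hi⟩
    exact hya i hi
  let C := L1 ++ [a]
  have hC : C.length = rb := by simp [C, hL1]; omega
  have hCn : C.Nodup := by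
    rw [List.nodup_append']
    exact ⟨hn1, by simp, by simpa using haL1⟩
  obtain ⟨lab, -, hlab⟩ := Finset.exists_lt_card_fiber_of_mul_lt_card_of_maps_to
    (s := S) (t := (Finset.univ : Finset (Fin C.length → Fin l)))
    (f := fun u i => (⟨label l r c (C.get i) u, by
      have : label l r c (C.get i) u ≤ l - 1 := Nat.findGreatest_le _
      omega⟩ : Fin l))
    (n := t l (k - rb)) (by intro u _; simp) (by simpa [hC] using ha)
  obtain ⟨u, w, L2, hu, hw, hT2, hn2, hL2⟩ := t_spec hne2 hr c _ hlab hf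
  have huS := (Finset.mem_filter.1 hu).1
  have hua : c v u = a := (Finset.mem_filter.1 huS).2
  have hvu : r v u := (Finset.mem_filter.1 (Finset.mem_filter.1 huS).1).2
  have hdis : List.Disjoint C L2 := by
    intro b hbC hbL
    obtain ⟨p, q, ⟨hpq, hp, hq⟩, rfl⟩ := hT2.colour_mem b hbL
    obtain ⟨i, hi⟩ := List.get_of_mem hbC
    have h1 := congrFun ((Finset.mem_filter.1 hp).2.trans (Finset.mem_filter.1 hq).2.symm) i
    simp only [hi, Fin.mk.injEq] at h1
    exact absurd h1 (label_lt_label hl hf hpq).ne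
  refine hrain (hasRainbow_iff.2 ⟨y 0, w, C ++ L2, ?_, ?_, ?_⟩)
  · refine Tr.append (v := u) ?_ (hT2.mono fun _ _ h => h.1)
    have := hT1.append (Tr.single (c := c) hvu)
    rwa [hua] at this
  · rw [List.nodup_append']
    exact ⟨hCn, hn2, hdis⟩
  · simp only [List.length_append, hC, hL2]; omega
end
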